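/- arXiv:1009.3386 — 6 statements merged into one kernel-verified Lean document; each statement's English description precedes it below -/
import Mathlib

section
/- Let N ≥ 3, let A : S^{N−1} → ℝ^N and a : S^{N−1} → ℝ be bounded and measurable, and assume ‖a‖_{L^∞} < (N−2)²/4. Then there exist constants 0 < c ≤ C such that for every u ∈ C_c^∞(ℝ^N∖{0}, ℂ): c·∫_{ℝ^N}|∇u(x)|² dx ≤ Q_{A,a}(u) ≤ C·∫_{ℝ^N}|∇u(x)|² dx; in particular the quadratic form Q_{A,a} is positive definite and equivalent to ∫_{ℝ^N}|∇_A u|² on C_c^∞(ℝ^N∖{0}). -/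
open MeasureTheory Complex Filter Metric

noncomputable def grad2 (N : ℕ) (u : EuclideanSpace ℝ (Fin N) → ℂ)
    (x : EuclideanSpace ℝ (Fin N)) : ℝ :=
  ∑ j : Fin N, ‖fderiv ℝ u x (EuclideanSpace.single j 1)‖ ^ 2

noncomputable def magGrad2 (N : ℕ) (A : EuclideanSpace ℝ (Fin N) → EuclideanSpace ℝ (Fin N))
    (u : EuclideanSpace ℝ (Fin N) → ℂ) (x : EuclideanSpace ℝ (Fin N)) : ℝ :=
  ∑ j : Fin N, ‖Complex.I * fderiv ℝ u x (EuclideanSpace.single j 1)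
      - ((A (‖x‖⁻¹ • x) j / ‖x‖ : ℝ) : ℂ) * u x‖ ^ 2

/-- the quadratic form `Q_{A,a}(u) = ∫ |∇_A u|² − ∫ (a(x/|x|)/|x|²)|u|²`. -/
noncomputable def Qf (N : ℕ) (A : EuclideanSpace ℝ (Fin N) → EuclideanSpace ℝ (Fin N))
    (a : EuclideanSpace ℝ (Fin N) → ℝ) (u : EuclideanSpace ℝ (Fin N) → ℂ) : ℝ :=
  (∫ x, magGrad2 N A u x) - ∫ x, (a (‖x‖⁻¹ • x) / ‖x‖ ^ 2) * ‖u x‖ ^ 2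


abbrev EN (N : ℕ) := EuclideanSpace ℝ (Fin N)

noncomputable def wf (N : ℕ) (u : EN N → ℂ) (x : EN N) : ℝ := (‖x‖ ^ 2)⁻¹ * ‖u x‖ ^ 2

noncomputable def gf (N : ℕ) (u : EN N → ℂ) (j : Fin N) (x : EN N) : ℝ := x j * wf N u x

lemma u_ev {N : ℕ} {u : EN N → ℂ} (h0 : (0 : EN N) ∉ tsupport u) :
    u =ᶠ[nhds 0] 0 := notMem_tsupport_iff_eventuallyEq.mp h0

lemma wf_ev {N : ℕ} {u : EN N → ℂ} (h0 : (0 : EN N) ∉ tsupport u) :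
    wf N u =ᶠ[nhds 0] 0 := by
  filter_upwards [u_ev h0] with x hx
  simp [wf, hx]

lemma wf_cd {N : ℕ} {u : EN N → ℂ} (hu : ContDiff ℝ (⊤ : ℕ∞) u)
    (h0 : (0 : EN N) ∉ tsupport u) : ContDiff ℝ 1 (wf N u) := by
  rw [contDiff_iff_contDiffAt]
  intro x
  by_cases hx : x = 0
  · subst hx
    exact (contDiffAt_const (c := (0:ℝ))).congr_of_eventuallyEq (wf_ev h0)
  · unfold wf
    have hu1 : ContDiff ℝ 1 u := hu.of_le (by exact_mod_cast le_top)
    exact ((contDiff_norm_sq ℝ).contDiffAt.inv (by simpa using hx)).mul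
      (hu1.norm_sq ℝ).contDiffAt

lemma gf_cd {N : ℕ} {u : EN N → ℂ} (hu : ContDiff ℝ (⊤ : ℕ∞) u)
    (h0 : (0 : EN N) ∉ tsupport u) (j : Fin N) : ContDiff ℝ 1 (gf N u j) := by
  have : ContDiff ℝ 1 (fun x : EN N => x j) := by fun_prop
  exact this.mul (wf_cd hu h0)

lemma wf_cs {N : ℕ} {u : EN N → ℂ} (hc : HasCompactSupport u) : HasCompactSupport (wf N u) := by
  refine hc.mono ?_
  intro x hx
  simp only [Function.mem_support, wf] at hx ⊢
  intro h
  simp [h] at hx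

lemma gf_cs {N : ℕ} {u : EN N → ℂ} (hc : HasCompactSupport u) (j : Fin N) :
    HasCompactSupport (gf N u j) := (wf_cs hc).mul_left

lemma gf_int {N : ℕ} {u : EN N → ℂ} (hu : ContDiff ℝ (⊤ : ℕ∞) u)
    (hc : HasCompactSupport u) (h0 : (0 : EN N) ∉ tsupport u) (j : Fin N) :
    Integrable (fun x => fderiv ℝ (gf N u j) x (EuclideanSpace.single j 1)) := by
  refine Continuous.integrable_of_hasCompactSupport ?_ ((gf_cs hc j).fderiv_apply ℝ _)
  exact ((gf_cd hu h0 j).continuous_fderiv (by norm_num)).clm_apply continuous_const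

lemma gf_zero {N : ℕ} {u : EN N → ℂ} (hu : ContDiff ℝ (⊤ : ℕ∞) u)
    (hc : HasCompactSupport u) (h0 : (0 : EN N) ∉ tsupport u) (j : Fin N) :
    ∫ x, fderiv ℝ (gf N u j) x (EuclideanSpace.single j 1) = 0 := by
  have := integral_mul_fderiv_eq_neg_fderiv_mul_of_integrable (𝕜 := ℝ)
    (μ := (volume : Measure (EN N)))
    (f := fun _ => (1:ℝ)) (g := gf N u j) (v := EuclideanSpace.single j 1) (by simp)
    (by simpa using gf_int hu hc h0 j)
    (by simpa using (gf_cd hu h0 j).continuous.integrable_of_hasCompactSupport (gf_cs hc j))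
    (fun x _ => by fun_prop) (fun x _ => (gf_cd hu h0 j).differentiable (by norm_num) x)
  simpa using this

lemma gf_deriv {N : ℕ} {u : EN N → ℂ} (hu : ContDiff ℝ (⊤ : ℕ∞) u)
    (j : Fin N) (x : EN N) (hx : x ≠ 0) :
    fderiv ℝ (gf N u j) x (EuclideanSpace.single j 1) =
      wf N u x - 2 * (x j) ^ 2 * (‖x‖ ^ 2)⁻¹ * wf N u x
       + 2 * x j * (‖x‖ ^ 2)⁻¹ * inner ℝ (u x) (fderiv ℝ u x (EuclideanSpace.single j 1)) := by
  have hne : ‖x‖ ^ 2 ≠ 0 := by simpa using hx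
  have h1 : HasFDerivAt (fun y : EN N => y j) (EuclideanSpace.proj j : EN N →L[ℝ] ℝ) x :=
    (EuclideanSpace.proj j : EN N →L[ℝ] ℝ).hasFDerivAt
  have h2 := (hasFDerivAt_id (𝕜 := ℝ) x).norm_sq
  have h3 := (hasDerivAt_inv hne).comp_hasFDerivAt x h2
  have h4 := ((hu.differentiable (by simp)) x).hasFDerivAt.norm_sq
  have h5 := h1.mul (h3.mul h4)
  have h6 : HasFDerivAt (gf N u j) _ x := h5
  rw [h6.fderiv]
  simp [wf, EuclideanSpace.inner_single_right]
  field_simp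
  ring

lemma grad2_int {N : ℕ} {u : EN N → ℂ} (hu : ContDiff ℝ (⊤ : ℕ∞) u)
    (hc : HasCompactSupport u) : Integrable (grad2 N u) := by
  unfold grad2
  refine integrable_finsetSum _ fun j _ => ?_
  refine Continuous.integrable_of_hasCompactSupport ?_ ?_
  · exact (((hu.continuous_fderiv (by simp)).clm_apply continuous_const).norm).pow 2
  · exact (hc.fderiv_apply ℝ _).comp_left (g := fun z : ℂ => ‖z‖ ^ 2) (by simp)

lemma wf_int {N : ℕ} {u : EN N → ℂ} (hu : ContDiff ℝ (⊤ : ℕ∞) u)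
    (hc : HasCompactSupport u) (h0 : (0 : EN N) ∉ tsupport u) : Integrable (wf N u) :=
  (wf_cd hu h0).continuous.integrable_of_hasCompactSupport (wf_cs hc)

lemma norm_sq2 (z : ℂ) : ‖z‖ ^ 2 = z.re ^ 2 + z.im ^ 2 := by
  rw [Complex.sq_norm, Complex.normSq_apply]; ring

lemma sumA {N : ℕ} (v : EN N) : ∑ j, (v j) ^ 2 = ‖v‖ ^ 2 := by
  rw [EuclideanSpace.norm_sq_eq]; simp

lemma pw_sum {N : ℕ} {A : EN N → EN N} {CA : ℝ} (hA : ∀ θ, ‖A θ‖ ≤ CA) (u : EN N → ℂ) (x : EN N) :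
    ∑ j : Fin N, ‖((A (‖x‖⁻¹ • x) j / ‖x‖ : ℝ) : ℂ) * u x‖ ^ 2 ≤ CA ^ 2 * wf N u x := by
  have : ∀ j : Fin N, ‖((A (‖x‖⁻¹ • x) j / ‖x‖ : ℝ) : ℂ) * u x‖ ^ 2
      = (A (‖x‖⁻¹ • x) j) ^ 2 * wf N u x := by
    intro j
    rw [norm_mul, Complex.norm_real, mul_pow, Real.norm_eq_abs, sq_abs, wf, div_pow]
    ring
  simp_rw [this]
  rw [← Finset.sum_mul, sumA]
  have hw : 0 ≤ wf N u x := by unfold wf; positivity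
  have := hA (‖x‖⁻¹ • x)
  gcongr

lemma sq_le1 (z w : ℂ) : ‖Complex.I * z - w‖ ^ 2 ≤ 2 * ‖z‖ ^ 2 + 2 * ‖w‖ ^ 2 := by
  simp only [norm_sq2]
  simp
  nlinarith [sq_nonneg (-z.im + w.re), sq_nonneg (z.re + w.im)]

lemma sq_le2 (z w : ℂ) : ‖z‖ ^ 2 ≤ 2 * ‖Complex.I * z - w‖ ^ 2 + 2 * ‖w‖ ^ 2 := by
  simp only [norm_sq2]
  simp
  nlinarith [sq_nonneg (-z.im - 2 * w.re), sq_nonneg (z.re - 2 * w.im)]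

lemma pw_up {N : ℕ} {A : EN N → EN N} {CA : ℝ} (hA : ∀ θ, ‖A θ‖ ≤ CA) (u : EN N → ℂ) (x : EN N) :
    magGrad2 N A u x ≤ 2 * grad2 N u x + 2 * CA ^ 2 * wf N u x := by
  have h := pw_sum hA u x
  have : magGrad2 N A u x ≤ 2 * grad2 N u x +
      2 * ∑ j : Fin N, ‖((A (‖x‖⁻¹ • x) j / ‖x‖ : ℝ) : ℂ) * u x‖ ^ 2 := by
    unfold magGrad2 grad2
    rw [Finset.mul_sum, Finset.mul_sum, ← Finset.sum_add_distrib]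
    exact Finset.sum_le_sum fun j _ => sq_le1 _ _
  linarith

lemma pw_low {N : ℕ} {A : EN N → EN N} {CA : ℝ} (hA : ∀ θ, ‖A θ‖ ≤ CA) (u : EN N → ℂ) (x : EN N) :
    grad2 N u x ≤ 2 * magGrad2 N A u x + 2 * CA ^ 2 * wf N u x := by
  have h := pw_sum hA u x
  have : grad2 N u x ≤ 2 * magGrad2 N A u x +
      2 * ∑ j : Fin N, ‖((A (‖x‖⁻¹ • x) j / ‖x‖ : ℝ) : ℂ) * u x‖ ^ 2 := by
    unfold magGrad2 grad2
    rw [Finset.mul_sum, Finset.mul_sum, ← Finset.sum_add_distrib]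
    exact Finset.sum_le_sum fun j _ => sq_le2 _ _
  linarith

lemma magGrad2_nonneg {N : ℕ} (A : EN N → EN N) (u : EN N → ℂ) (x : EN N) :
    0 ≤ magGrad2 N A u x := by unfold magGrad2; positivity

lemma mag_int {N : ℕ} {A : EN N → EN N} {CA : ℝ} (hAm : Measurable A) (hA : ∀ θ, ‖A θ‖ ≤ CA)
    {u : EN N → ℂ} (hu : ContDiff ℝ (⊤ : ℕ∞) u)
    (hc : HasCompactSupport u) (h0 : (0 : EN N) ∉ tsupport u) : Integrable (magGrad2 N A u) := by
  refine Integrable.mono' (((grad2_int hu hc).const_mul 2).add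
    ((wf_int hu hc h0).const_mul (2 * CA ^ 2))) ?_ (ae_of_all _ fun x => ?_)
  · refine Measurable.aestronglyMeasurable ?_
    unfold magGrad2
    have hn : Measurable (fun x : EN N => ‖x‖⁻¹ • x) := by fun_prop
    have hA2 := hAm.comp hn
    have hum : Measurable u := hu.continuous.measurable
    refine Finset.measurable_sum _ fun j _ => ?_
    have hd : Measurable (fun x => fderiv ℝ u x (EuclideanSpace.single j 1)) :=
      ((hu.continuous_fderiv (by simp)).clm_apply continuous_const).measurable
    have hj : Measurable (fun x : EN N => A (‖x‖⁻¹ • x) j) :=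
      (EuclideanSpace.proj j : EN N →L[ℝ] ℝ).continuous.measurable.comp hA2
    have hq : Measurable (fun x : EN N => ((A (‖x‖⁻¹ • x) j / ‖x‖ : ℝ) : ℂ)) :=
      Complex.measurable_ofReal.comp (hj.div measurable_norm)
    exact (((hd.const_mul _).sub (hq.mul hum)).norm).pow_const 2
  · rw [Real.norm_of_nonneg (magGrad2_nonneg _ _ _)]
    exact pw_up hA u x

lemma key_alg (z w : ℂ) (p q : ℝ) :
    -(2 * q * inner ℝ w z) - q ^ 2 * ‖w‖ ^ 2 ≤ ‖Complex.I * z - (p : ℂ) * w‖ ^ 2 := by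
  have : 0 ≤ ‖Complex.I * z - (p : ℂ) * w + Complex.I * (q : ℂ) * w‖ ^ 2 := by positivity
  rw [Complex.inner]
  simp only [norm_sq2] at *
  simp at *
  nlinarith

lemma hardy_pw {N : ℕ} (A : EN N → EN N) {u : EN N → ℂ} (hu : ContDiff ℝ (⊤ : ℕ∞) u)
    (h0 : (0 : EN N) ∉ tsupport u) (l : ℝ) (x : EN N) :
    (l * (N - 2) - l ^ 2) * wf N u x
      - l * ∑ j : Fin N, fderiv ℝ (gf N u j) x (EuclideanSpace.single j 1) ≤ magGrad2 N A u x := by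
  by_cases hx : x = 0
  · subst hx
    have h1 : ∀ j, fderiv ℝ (gf N u j) 0 = 0 := by
      intro j
      have : gf N u j =ᶠ[nhds 0] fun _ => 0 := by
        filter_upwards [wf_ev h0] with y hy
        simp [gf, hy]
      rw [this.fderiv_eq]; simp
    have h2 : wf N u 0 = 0 := by simp [wf]
    simp [h1, h2, magGrad2_nonneg]
  · have hne : ‖x‖ ^ 2 ≠ 0 := by simpa using hx
    have hs : ∑ j : Fin N, fderiv ℝ (gf N u j) x (EuclideanSpace.single j 1)
      = (N - 2) * wf N u x + ∑ j : Fin N, 2 * (x j * (‖x‖ ^ 2)⁻¹) *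
          inner ℝ (u x) (fderiv ℝ u x (EuclideanSpace.single j 1)) := by
      simp_rw [fun j => gf_deriv hu j x hx]
      rw [Finset.sum_add_distrib, Finset.sum_sub_distrib, ← Finset.sum_mul, ← Finset.sum_mul,
        ← Finset.mul_sum, sumA]
      simp only [Finset.sum_const, Finset.card_univ, Fintype.card_fin, nsmul_eq_mul]
      congr 1
      · field_simp
      · exact Finset.sum_congr rfl fun j _ => by ring
    have hb : ∑ j : Fin N, (-(2 * (l * (x j * (‖x‖ ^ 2)⁻¹)) *
          inner ℝ (u x) (fderiv ℝ u x (EuclideanSpace.single j 1)))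
          - (l * (x j * (‖x‖ ^ 2)⁻¹)) ^ 2 * ‖u x‖ ^ 2) ≤ magGrad2 N A u x := by
      unfold magGrad2
      exact Finset.sum_le_sum fun j _ => key_alg _ _ _ _
    have hq : ∑ j : Fin N, (l * (x j * (‖x‖ ^ 2)⁻¹)) ^ 2 * ‖u x‖ ^ 2 = l ^ 2 * wf N u x := by
      have : ∀ j : Fin N, (l * (x j * (‖x‖ ^ 2)⁻¹)) ^ 2 * ‖u x‖ ^ 2
        = (x j) ^ 2 * (l ^ 2 * ((‖x‖ ^ 2)⁻¹) * wf N u x) := by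
        intro j; unfold wf; ring
      simp_rw [this]
      rw [← Finset.sum_mul, sumA]
      field_simp
    have hr : ∑ j : Fin N, (2 * (l * (x j * (‖x‖ ^ 2)⁻¹)) *
          inner ℝ (u x) (fderiv ℝ u x (EuclideanSpace.single j 1)))
         = l * ∑ j : Fin N, 2 * (x j * (‖x‖ ^ 2)⁻¹) *
          inner ℝ (u x) (fderiv ℝ u x (EuclideanSpace.single j 1)) := by
      rw [Finset.mul_sum]
      refine Finset.sum_congr rfl fun j _ => by ring
    rw [Finset.sum_sub_distrib, Finset.sum_neg_distrib, hq, hr] at hb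
    rw [hs]
    linarith

lemma hardy {N : ℕ} {A : EN N → EN N} {CA : ℝ} (hAm : Measurable A) (hA : ∀ θ, ‖A θ‖ ≤ CA)
    {u : EN N → ℂ} (hu : ContDiff ℝ (⊤ : ℕ∞) u)
    (hc : HasCompactSupport u) (h0 : (0 : EN N) ∉ tsupport u) :
    ((N : ℝ) - 2) ^ 2 / 4 * ∫ x, wf N u x ≤ ∫ x, magGrad2 N A u x := by
  have hi1 := (wf_int hu hc h0).const_mul
    ((((N : ℝ) - 2) / 2) * (N - 2) - (((N : ℝ) - 2) / 2) ^ 2)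
  have hi2 := (integrable_finsetSum Finset.univ
    fun j _ => gf_int hu hc h0 j).const_mul (((N : ℝ) - 2) / 2)
  have := integral_mono (hi1.sub hi2) (mag_int hAm hA hu hc h0)
    (fun x => hardy_pw A hu h0 (((N : ℝ) - 2) / 2) x)
  simp only [Pi.sub_apply] at this
  rw [integral_sub hi1 hi2, integral_const_mul, integral_const_mul,
    integral_finsetSum _ fun j _ => gf_int hu hc h0 j] at this
  simp only [gf_zero hu hc h0] at this
  simp at this
  refine le_trans (le_of_eq ?_) this
  ring

lemma mag_zero (N : ℕ) (u : EN N → ℂ) : magGrad2 N (fun _ => 0) u = grad2 N u := by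
  funext x
  simp [magGrad2, grad2]

/-- for bounded measurable `A`, `a` with `‖a‖_∞ < (N−2)²/4`, the quadratic
form `Q_{A,a}` is equivalent to the Dirichlet form on `C_c^∞(ℝ^N∖{0})`; in particular
it is positive definite. -/
theorem stmt_2 (N : ℕ) (hN : 3 ≤ N)
    (A : EuclideanSpace ℝ (Fin N) → EuclideanSpace ℝ (Fin N))
    (hAmeas : Measurable A) (CA : ℝ) (hAbd : ∀ θ : EuclideanSpace ℝ (Fin N), ‖A θ‖ ≤ CA)
    (a : EuclideanSpace ℝ (Fin N) → ℝ) (hameas : Measurable a)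
    (Ma : ℝ) (habd : ∀ θ : EuclideanSpace ℝ (Fin N), |a θ| ≤ Ma)
    (hMa : Ma < ((N : ℝ) - 2) ^ 2 / 4) :
    ∃ c C : ℝ, 0 < c ∧ c ≤ C ∧
      ∀ u : EuclideanSpace ℝ (Fin N) → ℂ, ContDiff ℝ (⊤ : ℕ∞) u → HasCompactSupport u →
        (0 : EuclideanSpace ℝ (Fin N)) ∉ tsupport u →
        c * (∫ x, grad2 N u x) ≤ Qf N A a u ∧
        Qf N A a u ≤ C * (∫ x, grad2 N u x) := by
  have hK : 0 < ((N : ℝ) - 2) ^ 2 / 4 := by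
    have : (3:ℝ) ≤ N := by exact_mod_cast hN
    have : 0 < (N:ℝ) - 2 := by linarith
    positivity
  set K := ((N : ℝ) - 2) ^ 2 / 4 with hKdef
  have hMa0 : 0 ≤ Ma := (abs_nonneg _).trans (habd 0)
  have hB : 0 ≤ CA ^ 2 / K := by positivity
  have hMK : Ma / K < 1 := by rwa [div_lt_one hK]
  have hMK0 : 0 ≤ Ma / K := by positivity
  set B := 2 + 2 * (CA ^ 2 / K) with hBdef
  have hB2 : 2 ≤ B := by linarith
  refine ⟨(1 - Ma / K) / B, B + Ma / K, by apply div_pos <;> linarith, ?_, ?_⟩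
  · rw [div_le_iff₀ (by linarith)]
    nlinarith
  intro u hu hc h0
  have hH := hardy hAmeas hAbd hu hc h0
  have hH0 := hardy (A := fun _ => 0) (CA := 0) measurable_const (by simp) hu hc h0
  rw [mag_zero] at hH0
  rw [← hKdef] at hH hH0
  have iw := wf_int hu hc h0
  have ig := grad2_int hu hc
  have im := mag_int hAmeas hAbd hu hc h0
  have h1 := integral_mono im ((ig.const_mul 2).add (iw.const_mul (2 * CA ^ 2)))
    (fun x => pw_up hAbd u x)
  have h2 := integral_mono ig ((im.const_mul 2).add (iw.const_mul (2 * CA ^ 2)))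
    (fun x => pw_low hAbd u x)
  simp only [Pi.add_apply] at h1 h2
  rw [integral_add (ig.const_mul 2) (iw.const_mul (2 * CA ^ 2)), integral_const_mul,
    integral_const_mul] at h1
  rw [integral_add (im.const_mul 2) (iw.const_mul (2 * CA ^ 2)), integral_const_mul,
    integral_const_mul] at h2
  have h3 : |∫ x, (a (‖x‖⁻¹ • x) / ‖x‖ ^ 2) * ‖u x‖ ^ 2| ≤ Ma * ∫ x, wf N u x := by
    rw [← integral_const_mul, ← Real.norm_eq_abs]
    refine norm_integral_le_of_norm_le (iw.const_mul Ma) (ae_of_all _ fun x => ?_)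
    have hw : 0 ≤ wf N u x := by unfold wf; positivity
    have : a (‖x‖⁻¹ • x) / ‖x‖ ^ 2 * ‖u x‖ ^ 2 = a (‖x‖⁻¹ • x) * wf N u x := by
      unfold wf; ring
    rw [this, norm_mul, Real.norm_of_nonneg hw, Real.norm_eq_abs]
    exact mul_le_mul_of_nonneg_right (habd _) hw
  have h3' := abs_le.mp h3
  unfold Qf
  set H := ∫ x, wf N u x
  set D := ∫ x, grad2 N u x
  set M := ∫ x, magGrad2 N A u x
  set P := ∫ x, (a (‖x‖⁻¹ • x) / ‖x‖ ^ 2) * ‖u x‖ ^ 2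
  have e1 : H ≤ M / K := by rw [le_div_iff₀ hK]; linarith
  have e2 : H ≤ D / K := by rw [le_div_iff₀ hK]; linarith
  have f1 : Ma * H ≤ Ma / K * M := by
    calc Ma * H ≤ Ma * (M / K) := by gcongr
      _ = _ := by ring
  have f2 : Ma * H ≤ Ma / K * D := by
    calc Ma * H ≤ Ma * (D / K) := by gcongr
      _ = _ := by ring
  have f3 : CA ^ 2 * H ≤ CA ^ 2 / K * M := by
    calc CA ^ 2 * H ≤ CA ^ 2 * (M / K) := by gcongr
      _ = _ := by ring
  have f4 : CA ^ 2 * H ≤ CA ^ 2 / K * D := by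
    calc CA ^ 2 * H ≤ CA ^ 2 * (D / K) := by gcongr
      _ = _ := by ring
  constructor
  · have g1 : D ≤ B * M := by rw [hBdef]; linarith
    have g2 : (1 - Ma / K) / B * D ≤ (1 - Ma / K) * M := by
      rw [div_mul_eq_mul_div, div_le_iff₀ (by linarith), mul_assoc, mul_comm M B]
      exact mul_le_mul_of_nonneg_left g1 (by linarith)
    linarith
  · rw [hBdef]; linarith
end

section
/- Let N ≥ 4. There exists a constant C > 0, depending only on N, such that for every R ≥ 2 and every point p ∈ ℝ^N with |p| = R: ∫_{ℝ^N} U_p(x)²/|x|² dx ≤ C·log(R)/R² if N = 4, and ∫_{ℝ^N} U_p(x)²/|x|² dx ≤ C/R² if N ≥ 5. -/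
open MeasureTheory Complex Filter Metric

/-- the standard Aubin–Talenti bubble `U_p(x) = (N(N−2))^{(N−2)/4}(1+|x−p|²)^{−(N−2)/2}`. -/
noncomputable def bubble (N : ℕ) (p x : EuclideanSpace ℝ (Fin N)) : ℝ :=
  ((N : ℝ) * ((N : ℝ) - 2)) ^ (((N : ℝ) - 2) / 4) *
    (1 + ‖x - p‖ ^ 2) ^ (-(((N : ℝ) - 2) / 2))

/-- the area constant of the unit sphere. -/
noncomputable def kap (N : ℕ) : ℝ :=
  (N : ℝ) * (volume : Measure (EuclideanSpace ℝ (Fin N))).real (ball 0 1)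

lemma kap_nonneg (N : ℕ) : 0 ≤ kap N := by unfold kap; positivity

lemma rad (N : ℕ) (hN : 0 < N) (t : Set ℝ) (ht : MeasurableSet t) (h : ℝ → ℝ)
    (hint : IntegrableOn (fun r : ℝ => r ^ (N - 1) * h r) (Set.Ioi 0 ∩ t)) :
    Integrable (fun x : EuclideanSpace ℝ (Fin N) => t.indicator h ‖x‖) ∧
    ∫ x : EuclideanSpace ℝ (Fin N), t.indicator h ‖x‖
      = kap N * ∫ r in Set.Ioi 0 ∩ t, r ^ (N - 1) * h r := by
  have : Nonempty (Fin N) := ⟨⟨0, hN⟩⟩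
  have e : (fun y : ℝ => y ^ (N - 1) • t.indicator h y)
      = t.indicator (fun r => r ^ (N - 1) * h r) := by
    ext y
    by_cases hy : y ∈ t <;> simp [hy]
  constructor
  · rw [integrable_fun_norm_addHaar volume (f := t.indicator h), finrank_euclideanSpace_fin, e,
      IntegrableOn, integrable_indicator_iff ht, IntegrableOn, Measure.restrict_restrict ht,
      Set.inter_comm]
    exact hint
  · rw [integral_fun_norm_addHaar volume (t.indicator h), finrank_euclideanSpace_fin, e,
      setIntegral_indicator ht]
    simp [kap, mul_assoc]

lemma radA (N : ℕ) (hN : 4 ≤ N) (a : ℝ) (ha : 0 < a) :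
    Integrable (fun x : EuclideanSpace ℝ (Fin N) =>
      (Set.Iic a).indicator (fun r : ℝ => (r ^ 2)⁻¹) ‖x‖) ∧
    ∫ x : EuclideanSpace ℝ (Fin N), (Set.Iic a).indicator (fun r : ℝ => (r ^ 2)⁻¹) ‖x‖
      ≤ kap N * a ^ (N - 2) := by
  have e : Set.EqOn (fun r : ℝ => r ^ (N - 3)) (fun r : ℝ => r ^ (N - 1) * (r ^ 2)⁻¹)
      (Set.Ioi 0 ∩ Set.Iic a) := by
    rintro r ⟨hr, -⟩
    have hr : 0 < r := hr
    have : N - 1 = N - 3 + 2 := by omega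
    simp only [this, pow_add]
    field_simp
  have hm : MeasurableSet (Set.Ioi 0 ∩ Set.Iic a) := measurableSet_Ioi.inter measurableSet_Iic
  have h0 : IntegrableOn (fun r : ℝ => r ^ (N - 3)) (Set.Ioi 0 ∩ Set.Iic a) := by
    rw [Set.Ioi_inter_Iic]
    exact ((continuous_pow _).integrableOn_Icc).mono_set Set.Ioc_subset_Icc_self
  obtain ⟨h1, h2⟩ := rad N (by omega) (Set.Iic a) measurableSet_Iic (fun r : ℝ => (r ^ 2)⁻¹)
    (h0.congr_fun e hm)
  refine ⟨h1, ?_⟩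
  rw [h2, ← setIntegral_congr_fun hm e, Set.Ioi_inter_Iic,
    ← intervalIntegral.integral_of_le ha.le, integral_pow]
  apply mul_le_mul_of_nonneg_left _ (kap_nonneg N)
  have : N - 3 + 1 = N - 2 := by omega
  rw [this, zero_pow (by omega), sub_zero]
  apply div_le_self (by positivity)
  have := Nat.cast_nonneg (α := ℝ) (N - 3)
  linarith

lemma radC (a : ℝ) (ha : 0 < a) :
    Integrable (fun x : EuclideanSpace ℝ (Fin 4) =>
      (Set.Iic a).indicator (fun r : ℝ => ((1 + r ^ 2) ^ 2)⁻¹) ‖x‖) ∧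
    ∫ x : EuclideanSpace ℝ (Fin 4), (Set.Iic a).indicator (fun r : ℝ => ((1 + r ^ 2) ^ 2)⁻¹) ‖x‖
      ≤ kap 4 * (Real.log (1 + a ^ 2) / 2) := by
  have hc : Continuous (fun r : ℝ => r ^ (4 - 1) * ((1 + r ^ 2) ^ 2)⁻¹) := by
    apply Continuous.mul (by fun_prop)
    exact Continuous.inv₀ (by fun_prop) (fun x => by positivity)
  have hc' : Continuous (fun r : ℝ => r / (1 + r ^ 2)) := by
    exact Continuous.div₀ (by fun_prop) (by fun_prop) (fun x => by positivity)
  obtain ⟨h1, h2⟩ := rad 4 (by omega) (Set.Iic a) measurableSet_Iic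
    (fun r : ℝ => ((1 + r ^ 2) ^ 2)⁻¹) (by
      rw [Set.Ioi_inter_Iic]
      exact hc.integrableOn_Icc.mono_set Set.Ioc_subset_Icc_self)
  refine ⟨h1, ?_⟩
  rw [h2, Set.Ioi_inter_Iic, ← intervalIntegral.integral_of_le ha.le]
  apply mul_le_mul_of_nonneg_left _ (kap_nonneg 4)
  have hd : ∫ r in (0:ℝ)..a, r / (1 + r ^ 2) = Real.log (1 + a ^ 2) / 2 - Real.log (1 + 0 ^ 2) / 2 := by
    apply intervalIntegral.integral_eq_sub_of_hasDerivAt (f := fun r => Real.log (1 + r ^ 2) / 2)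
    · intro x _
      have h0 : HasDerivAt (fun r : ℝ => 1 + r ^ 2) (2 * x) x := by
        simpa using (hasDerivAt_pow 2 x).const_add 1
      have h := (h0.log (show 1 + x ^ 2 ≠ 0 by positivity)).div_const 2
      refine h.congr_deriv ?_
      field_simp
    · exact hc'.intervalIntegrable _ _
  have hd2 : ∫ r in (0:ℝ)..a, r / (1 + r ^ 2) = Real.log (1 + a ^ 2) / 2 := by
    rw [hd]; simp
  rw [← hd2]
  apply intervalIntegral.integral_mono_on ha.le (hc.intervalIntegrable _ _)
    (hc'.intervalIntegrable _ _)
  rintro r ⟨hr, -⟩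
  rw [← div_eq_mul_inv, div_le_div_iff₀ (by positivity) (by positivity)]
  have : 0 ≤ r * (1 + r ^ 2) := by positivity
  norm_num
  nlinarith

lemma radD (a : ℝ) (ha : 0 < a) :
    Integrable (fun x : EuclideanSpace ℝ (Fin 4) =>
      (Set.Ioi a).indicator (fun r : ℝ => (r ^ 6)⁻¹) ‖x‖) ∧
    ∫ x : EuclideanSpace ℝ (Fin 4), (Set.Ioi a).indicator (fun r : ℝ => (r ^ 6)⁻¹) ‖x‖
      ≤ kap 4 * (a ^ 2)⁻¹ := by
  have e0 : Set.Ioi 0 ∩ Set.Ioi a = Set.Ioi a := by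
    rw [Set.Ioi_inter_Ioi]; simp [ha.le]
  have e : Set.EqOn (fun r : ℝ => r ^ (-3 : ℝ)) (fun r : ℝ => r ^ (4 - 1) * (r ^ 6)⁻¹)
      (Set.Ioi a) := by
    intro r hr
    have hr : 0 < r := ha.trans hr
    simp only
    rw [Real.rpow_neg hr.le]
    norm_cast
    norm_num
    field_simp
  obtain ⟨h1, h2⟩ := rad 4 (by omega) (Set.Ioi a) measurableSet_Ioi
    (fun r : ℝ => (r ^ 6)⁻¹) (by
      rw [e0]
      exact (integrableOn_Ioi_rpow_of_lt (by norm_num) ha).congr_fun e measurableSet_Ioi)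
  refine ⟨h1, ?_⟩
  rw [h2, e0, ← setIntegral_congr_fun measurableSet_Ioi e,
    integral_Ioi_rpow_of_lt (by norm_num) ha]
  apply mul_le_mul_of_nonneg_left _ (kap_nonneg 4)
  have : a ^ ((-3 : ℝ) + 1) = (a ^ 2)⁻¹ := by
    rw [show ((-3 : ℝ) + 1) = -(2 : ℕ) by norm_num, Real.rpow_neg ha.le, Real.rpow_natCast]
  rw [this]
  have : 0 ≤ (a ^ 2)⁻¹ := by positivity
  norm_num only
  linarith

/-- the squared constant. -/
noncomputable def kk (N : ℕ) : ℝ := (((N : ℝ) * ((N : ℝ) - 2)) ^ (((N : ℝ) - 2) / 4)) ^ 2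

lemma bubble_sq (N : ℕ) (hN : 4 ≤ N) (p x : EuclideanSpace ℝ (Fin N)) :
    bubble N p x ^ 2 = kk N * ((1 + ‖x - p‖ ^ 2) ^ (N - 2))⁻¹ := by
  have h : (0:ℝ) < 1 + ‖x - p‖ ^ 2 := by positivity
  rw [bubble, mul_pow, kk, ← Real.rpow_natCast _ 2, ← Real.rpow_natCast _ 2,
    ← Real.rpow_mul h.le, ← Real.rpow_natCast _ (N - 2), ← Real.rpow_neg h.le,
    Nat.cast_sub (by omega)]
  congr 2
  push_cast
  ring

lemma near_bound (N : ℕ) (a : ℝ) (p x : EuclideanSpace ℝ (Fin N)) (ha : 0 < a)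
    (hp : ‖p‖ = 2 * a) (hx : ‖x‖ ≤ a) :
    ((1 + ‖x - p‖ ^ 2) ^ (N - 2))⁻¹ ≤ ((a ^ 2) ^ (N - 2))⁻¹ := by
  have h : a ≤ ‖x - p‖ := by
    have := norm_sub_norm_le p x
    rw [norm_sub_rev] at this
    linarith
  have : a ^ 2 ≤ 1 + ‖x - p‖ ^ 2 := by nlinarith
  gcongr

lemma near_const (N : ℕ) (hN : 4 ≤ N) (a : ℝ) (ha : 1 ≤ a) :
    ((a ^ 2) ^ (N - 2))⁻¹ * (kap N * a ^ (N - 2)) ≤ kap N * (a ^ 2)⁻¹ := by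
  have h0 : 0 < a := by linarith
  have h : (a ^ (N - 2))⁻¹ ≤ (a ^ 2)⁻¹ := by
    gcongr
    omega
  calc _ = kap N * (a ^ (N - 2))⁻¹ := by
        rw [← pow_mul, mul_comm 2, pow_mul]; field_simp
    _ ≤ _ := mul_le_mul_of_nonneg_left h (kap_nonneg N)

lemma case5 (N : ℕ) (hN : 5 ≤ N) (a : ℝ) (ha : 1 ≤ a) (p : EuclideanSpace ℝ (Fin N))
    (hp : ‖p‖ = 2 * a) :
    (∫ x, bubble N p x ^ 2 / ‖x‖ ^ 2) ≤ kk N * (kap N * (a ^ 2)⁻¹ + (a ^ 2)⁻¹ *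
      ∫ y : EuclideanSpace ℝ (Fin N), ((1 + ‖y‖ ^ 2) ^ (N - 2))⁻¹) := by
  have hk : 0 ≤ kk N := by unfold kk; positivity
  have h0 : 0 < a := by linarith
  have hI : Integrable (fun y : EuclideanSpace ℝ (Fin N) => ((1 + ‖y‖ ^ 2) ^ (N - 2))⁻¹) := by
    have h := integrable_rpow_neg_one_add_norm_sq (E := EuclideanSpace ℝ (Fin N)) (μ := volume)
      (r := 2 * ((N - 2 : ℕ) : ℝ)) (by
        rw [finrank_euclideanSpace_fin]
        norm_cast
        omega)
    refine h.congr (Eventually.of_forall fun y => ?_)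
    have h : (0:ℝ) < 1 + ‖y‖ ^ 2 := by positivity
    simp only
    rw [show -(2 * ((N - 2 : ℕ) : ℝ)) / 2 = -((N - 2 : ℕ) : ℝ) by ring, Real.rpow_neg h.le,
      Real.rpow_natCast]
  obtain ⟨hA, hA'⟩ := radA N (by omega) a h0
  have hI' := hI.comp_sub_right p
  have hG := ((hA.const_mul (((a ^ 2) ^ (N - 2))⁻¹)).add (hI'.const_mul ((a ^ 2)⁻¹))).const_mul
    (kk N)
  refine (integral_mono_of_nonneg (Eventually.of_forall fun x => by positivity) hG
    (Eventually.of_forall fun x => ?_)).trans ?_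
  · simp only [Pi.add_apply]
    rw [bubble_sq N (by omega), mul_div_assoc]
    apply mul_le_mul_of_nonneg_left _ hk
    rw [div_eq_mul_inv]
    by_cases hx : ‖x‖ ≤ a
    · rw [Set.indicator_of_mem (by exact hx)]
      have := near_bound N a p x h0 hp hx
      refine (mul_le_mul_of_nonneg_right this (by positivity)).trans ?_
      have : 0 ≤ (a ^ 2)⁻¹ * ((1 + ‖x - p‖ ^ 2) ^ (N - 2))⁻¹ := by positivity
      linarith
    · rw [Set.indicator_of_notMem (by exact hx), mul_zero, zero_add, mul_comm]
      push Not at hx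
      gcongr
  · simp only [Pi.add_apply]
    rw [integral_const_mul, integral_add (hA.const_mul _) (hI'.const_mul _), integral_const_mul,
      integral_const_mul,
      integral_sub_right_eq_self (fun y : EuclideanSpace ℝ (Fin N) => ((1 + ‖y‖ ^ 2) ^ (N - 2))⁻¹)]
    apply mul_le_mul_of_nonneg_left _ hk
    apply add_le_add _ le_rfl
    exact (mul_le_mul_of_nonneg_left hA' (by positivity)).trans (near_const N (by omega) a ha)

lemma case4 (a : ℝ) (ha : 1 ≤ a) (p : EuclideanSpace ℝ (Fin 4))
    (hp : ‖p‖ = 2 * a) :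
    (∫ x, bubble 4 p x ^ 2 / ‖x‖ ^ 2) ≤ kk 4 * (kap 4 * (a ^ 2)⁻¹ +
      ((a ^ 2)⁻¹ * (kap 4 * (Real.log (1 + (2 * a) ^ 2) / 2)) + 16 * (kap 4 * (a ^ 2)⁻¹))) := by
  have hk : 0 ≤ kk 4 := by unfold kk; positivity
  have h0 : 0 < a := by linarith
  obtain ⟨hA, hA'⟩ := radA 4 (by omega) a h0
  obtain ⟨hC, hC'⟩ := radC (2 * a) (by linarith)
  obtain ⟨hD, hD'⟩ := radD a h0
  have hI' := hC.comp_sub_right p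
  have hCD : Integrable (fun x : EuclideanSpace ℝ (Fin 4) =>
      (a ^ 2)⁻¹ * (Set.Iic (2 * a)).indicator (fun r : ℝ => ((1 + r ^ 2) ^ 2)⁻¹) ‖x - p‖
      + 16 * (Set.Ioi a).indicator (fun r : ℝ => (r ^ 6)⁻¹) ‖x‖) := (hI'.const_mul ((a ^ 2)⁻¹)).add (hD.const_mul 16)
  have hG := ((hA.const_mul (((a ^ 2) ^ (4 - 2))⁻¹)).add hCD).const_mul (kk 4)
  refine (integral_mono_of_nonneg (Eventually.of_forall fun x => by positivity) hG
    (Eventually.of_forall fun x => ?_)).trans ?_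
  · simp only [Pi.add_apply]
    rw [bubble_sq 4 (by omega), mul_div_assoc]
    apply mul_le_mul_of_nonneg_left _ hk
    rw [div_eq_mul_inv]
    have nC : 0 ≤ (Set.Iic (2 * a)).indicator (fun r : ℝ => ((1 + r ^ 2) ^ 2)⁻¹) ‖x - p‖ :=
      Set.indicator_nonneg (fun r _ => by positivity) _
    have nD : 0 ≤ (Set.Ioi a).indicator (fun r : ℝ => (r ^ 6)⁻¹) ‖x‖ :=
      Set.indicator_nonneg (fun r _ => by positivity) _
    have nC' := mul_nonneg (show 0 ≤ (a ^ 2)⁻¹ by positivity) nC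
    by_cases hx : ‖x‖ ≤ a
    · rw [Set.indicator_of_mem (s := Set.Iic a) (by exact hx)]
      have := near_bound 4 a p x h0 hp hx
      refine (mul_le_mul_of_nonneg_right this (by positivity)).trans ?_
      linarith
    · rw [Set.indicator_of_notMem (s := Set.Iic a) (by exact hx), mul_zero, zero_add]
      push Not at hx
      by_cases hy : ‖x - p‖ ≤ 2 * a
      · rw [Set.indicator_of_mem (s := Set.Iic (2 * a)) (by exact hy), mul_comm]
        refine le_trans ?_ (le_add_of_nonneg_right (mul_nonneg (by norm_num) nD))
        norm_num only
        gcongr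
      · push Not at hy
        rw [Set.indicator_of_mem (s := Set.Ioi a) (by exact hx)]
        refine le_trans ?_ (le_add_of_nonneg_left nC')
        have hxpos : 0 < ‖x‖ := h0.trans hx
        have h1 : ‖x‖ ≤ 2 * ‖x - p‖ := by
          have := norm_add_le (x - p) p
          rw [sub_add_cancel] at this
          linarith
        have h2 : ‖x‖ ^ 2 / 4 ≤ 1 + ‖x - p‖ ^ 2 := by nlinarith
        have h3 : ((1 + ‖x - p‖ ^ 2) ^ (4 - 2))⁻¹ ≤ ((‖x‖ ^ 2 / 4) ^ (4 - 2))⁻¹ := by gcongr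
        refine (mul_le_mul_of_nonneg_right h3 (by positivity)).trans (le_of_eq ?_)
        norm_num
        field_simp
        norm_num
  · simp only [Pi.add_apply]
    rw [integral_const_mul, integral_add (hA.const_mul _) hCD,
      integral_add (hI'.const_mul _) (hD.const_mul _), integral_const_mul,
      integral_const_mul, integral_const_mul,
      integral_sub_right_eq_self (fun y : EuclideanSpace ℝ (Fin 4) =>
        (Set.Iic (2 * a)).indicator (fun r : ℝ => ((1 + r ^ 2) ^ 2)⁻¹) ‖y‖)]
    apply mul_le_mul_of_nonneg_left _ hk
    refine add_le_add ?_ (add_le_add ?_ ?_)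
    · exact (mul_le_mul_of_nonneg_left hA' (by positivity)).trans (near_const 4 (by omega) a ha)
    · exact mul_le_mul_of_nonneg_left hC' (by positivity)
    · exact mul_le_mul_of_nonneg_left hD' (by positivity)

/-- `∫ U_p²/|x|² ≤ C log R / R²` if `N = 4` and `≤ C/R²` if `N ≥ 5`,
for `|p| = R ≥ 2`. -/
theorem stmt_9 (N : ℕ) (hN : 4 ≤ N) :
    ∃ C : ℝ, 0 < C ∧ ∀ R : ℝ, 2 ≤ R → ∀ p : EuclideanSpace ℝ (Fin N), ‖p‖ = R →
      (N = 4 → (∫ x, bubble N p x ^ 2 / ‖x‖ ^ 2) ≤ C * Real.log R / R ^ 2) ∧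
      (5 ≤ N → (∫ x, bubble N p x ^ 2 / ‖x‖ ^ 2) ≤ C / R ^ 2) := by
  have hk : 0 ≤ kk N := by unfold kk; positivity
  have hkap := kap_nonneg N
  have hI : 0 ≤ ∫ y : EuclideanSpace ℝ (Fin N), ((1 + ‖y‖ ^ 2) ^ (N - 2))⁻¹ :=
    integral_nonneg fun y => by positivity
  obtain ⟨I, hIdef⟩ : ∃ I, I = ∫ y : EuclideanSpace ℝ (Fin N), ((1 + ‖y‖ ^ 2) ^ (N - 2))⁻¹ :=
    ⟨_, rfl⟩
  rw [← hIdef] at hI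
  refine ⟨kk N * (200 * kap N + 4 * I) + 1, by positivity, ?_⟩
  intro R hR p hp
  have hR0 : 0 < R := by linarith
  have ea : ((R / 2) ^ 2)⁻¹ = 4 / R ^ 2 := by field_simp; norm_num
  constructor
  · intro h4
    subst h4
    refine (case4 (R / 2) (by linarith) p (by linarith)).trans ?_
    rw [ea, show 2 * (R / 2) = R by ring]
    have hl : 1 / 2 ≤ Real.log R := by
      have h1 := Real.log_two_gt_d9
      have h2 := Real.log_le_log (by norm_num) hR
      linarith
    have hl2 : Real.log (1 + R ^ 2) ≤ 3 * Real.log R := by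
      have : Real.log (1 + R ^ 2) ≤ Real.log (R ^ 3) :=
        Real.log_le_log (by positivity) (by nlinarith [sq_nonneg R])
      rw [Real.log_pow] at this
      exact_mod_cast this
    clear hIdef
    generalize kap 4 = κ at *
    generalize kk 4 = K at *
    rw [le_div_iff₀ (by positivity)]
    have h1 : κ * (68 + 2 * Real.log (1 + R ^ 2)) ≤ 200 * κ * Real.log R := by
      rw [mul_comm 200, mul_assoc]
      apply mul_le_mul_of_nonneg_left _ hkap
      linarith
    have h2 := mul_le_mul_of_nonneg_left h1 hk
    have h3 : 0 ≤ K * (4 * I) * Real.log R + Real.log R := by positivity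
    calc _ = K * (κ * (68 + 2 * Real.log (1 + R ^ 2))) := by field_simp; ring
      _ ≤ _ := by linarith
  · intro h5
    refine (case5 N h5 (R / 2) (by linarith) p (by linarith)).trans ?_
    rw [ea, ← hIdef, le_div_iff₀ (by positivity)]
    calc _ = kk N * (4 * kap N + 4 * I) := by field_simp; try ring
      _ ≤ _ := by nlinarith [mul_nonneg hk hkap]
end

section
/- Let N ≥ 4. There exists a constant C > 0, depending only on N, such that for every R ≥ 2 and all points p, q ∈ ℝ^N with |p| = |q| = R and |p − q| ≥ 2: ∫_{ℝ^N} (1/|x|) · |∇U_q(x)| · U_p(x) dx ≤ C / (R · |p − q|^{N−3}). -/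
open MeasureTheory Complex Filter Metric

/-- Radial integral of an inverse power over a ball. -/
lemma inner_int (m k j : ℕ) (hkj : k + j = m + 2) (ρ : ℝ) (hρ : 0 < ρ) :
    Integrable (fun x : EuclideanSpace ℝ (Fin (m + 3)) =>
        (Set.Iio ρ).indicator (fun t : ℝ => (t ^ k)⁻¹) ‖x‖) ∧
    (∫ x : EuclideanSpace ℝ (Fin (m + 3)),
        (Set.Iio ρ).indicator (fun t : ℝ => (t ^ k)⁻¹) ‖x‖) ≤
      ((m + 3 : ℕ) * (volume : Measure (EuclideanSpace ℝ (Fin (m + 3)))).real (ball 0 1))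
        * ρ ^ (j + 1) := by
  have hdim : Module.finrank ℝ (EuclideanSpace ℝ (Fin (m + 3))) = m + 3 := by simp
  have key : Set.EqOn (fun y : ℝ => y ^ (m + 3 - 1) •
      (Set.Iio ρ).indicator (fun t : ℝ => (t ^ k)⁻¹) y)
      ((Set.Iio ρ).indicator (fun y => y ^ j)) (Set.Ioi 0) := by
    intro y hy
    have hy0 : (0 : ℝ) < y := hy
    by_cases h : y < ρ
    · have : m + 3 - 1 = k + j := by omega
      simp only [Set.indicator, Set.mem_Iio, h, if_true, this, smul_eq_mul, pow_add]
      field_simp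
    · simp [Set.indicator, h]
  have hset : Set.Iio ρ ∩ Set.Ioi 0 = Set.Ioo 0 ρ := by
    ext; simp [and_comm]
  constructor
  · rw [integrable_fun_norm_addHaar, hdim, integrableOn_congr_fun key measurableSet_Ioi,
      IntegrableOn, integrable_indicator_iff measurableSet_Iio, IntegrableOn,
      Measure.restrict_restrict measurableSet_Iio, hset]
    exact ((continuous_pow j).integrableOn_Icc (a := 0) (b := ρ)).mono_set Set.Ioo_subset_Icc_self
  · rw [integral_fun_norm_addHaar, hdim, setIntegral_congr_fun measurableSet_Ioi key,
      integral_indicator measurableSet_Iio,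
      Measure.restrict_restrict measurableSet_Iio, hset, ← integral_Ioc_eq_integral_Ioo,
      ← intervalIntegral.integral_of_le hρ.le, integral_pow, nsmul_eq_mul, smul_eq_mul, ← mul_assoc]
    apply mul_le_mul_of_nonneg_left _ (by positivity)
    have : (0:ℝ) < ρ ^ (j + 1) := by positivity
    simp only [ne_eq, Nat.add_eq_zero_iff, one_ne_zero, and_false, not_false_eq_true, zero_pow,
      sub_zero]
    apply div_le_self this.le
    have : (0:ℝ) ≤ j := by positivity
    linarith

/-- Radial integral of an inverse power outside a ball. -/
lemma outer_int (m : ℕ) (hm : 1 ≤ m) (ρ : ℝ) (hρ : 0 < ρ) :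
    Integrable (fun x : EuclideanSpace ℝ (Fin (m + 3)) =>
        (Set.Ici ρ).indicator (fun t : ℝ => (t ^ (2 * m + 3))⁻¹) ‖x‖) ∧
    (∫ x : EuclideanSpace ℝ (Fin (m + 3)),
        (Set.Ici ρ).indicator (fun t : ℝ => (t ^ (2 * m + 3))⁻¹) ‖x‖) ≤
      ((m + 3 : ℕ) * (volume : Measure (EuclideanSpace ℝ (Fin (m + 3)))).real (ball 0 1))
        * (ρ ^ m)⁻¹ := by
  have hdim : Module.finrank ℝ (EuclideanSpace ℝ (Fin (m + 3))) = m + 3 := by simp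
  have hm' : (1 : ℝ) ≤ m := by exact_mod_cast hm
  have key : Set.EqOn (fun y : ℝ => y ^ (m + 3 - 1) •
      (Set.Ici ρ).indicator (fun t : ℝ => (t ^ (2 * m + 3))⁻¹) y)
      ((Set.Ici ρ).indicator (fun y => y ^ (-((m : ℝ) + 1)))) (Set.Ioi 0) := by
    intro y hy
    have hy0 : (0 : ℝ) < y := hy
    by_cases h : ρ ≤ y
    · have e1 : m + 3 - 1 = m + 2 := by omega
      have e2 : 2 * m + 3 = (m + 2) + (m + 1) := by omega
      have e3 : y ^ (-((m : ℝ) + 1)) = (y ^ (m + 1))⁻¹ := by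
        rw [Real.rpow_neg hy0.le, ← Real.rpow_natCast]; push_cast; rfl
      simp only [Set.indicator, Set.mem_Ici, h, if_true, e1, e2, e3, smul_eq_mul]
      rw [pow_add y (m + 2) (m + 1)]
      field_simp
    · simp [Set.indicator, h]
  have hset : Set.Ici ρ ∩ Set.Ioi 0 = Set.Ici ρ := by
    apply Set.inter_eq_left.2
    intro x hx
    exact lt_of_lt_of_le hρ hx
  constructor
  · rw [integrable_fun_norm_addHaar, hdim, integrableOn_congr_fun key measurableSet_Ioi,
      IntegrableOn, integrable_indicator_iff measurableSet_Ici, IntegrableOn,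
      Measure.restrict_restrict measurableSet_Ici, hset]
    exact (integrableOn_Ici_iff_integrableOn_Ioi).2
      (integrableOn_Ioi_rpow_of_lt (by linarith) hρ)
  · rw [integral_fun_norm_addHaar, hdim, setIntegral_congr_fun measurableSet_Ioi key,
      integral_indicator measurableSet_Ici,
      Measure.restrict_restrict measurableSet_Ici, hset, integral_Ici_eq_integral_Ioi,
      integral_Ioi_rpow_of_lt (by linarith) hρ, nsmul_eq_mul, smul_eq_mul, ← mul_assoc]
    apply mul_le_mul_of_nonneg_left _ (by positivity)
    have e : -((m : ℝ) + 1) + 1 = -m := by ring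
    rw [e, neg_div_neg_eq, Real.rpow_neg hρ.le, Real.rpow_natCast]
    apply div_le_self (by positivity) hm'

lemma rpow_half_le (k : ℕ) (a : ℝ) (ha : 0 < a) :
    (1 + a ^ 2) ^ (-((k : ℝ) / 2)) ≤ (a ^ k)⁻¹ := by
  rw [Real.rpow_neg (by positivity)]
  apply inv_anti₀ (by positivity)
  calc a ^ k = (a ^ 2) ^ ((k : ℝ) / 2) := by
        rw [← Real.rpow_natCast a 2, ← Real.rpow_mul ha.le, ← Real.rpow_natCast]
        congr 1; push_cast; ring
    _ ≤ _ := Real.rpow_le_rpow (by positivity) (by linarith) (by positivity)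

/-- the normalising constant -/
noncomputable def bconst (m : ℕ) : ℝ :=
  (((m + 3 : ℕ) : ℝ) * (((m + 3 : ℕ) : ℝ) - 2)) ^ ((((m + 3 : ℕ) : ℝ) - 2) / 4)

lemma bconst_pos (m : ℕ) : 0 < bconst m := by
  unfold bconst
  apply Real.rpow_pos_of_pos
  push_cast
  have : (0 : ℝ) ≤ m := by positivity
  nlinarith

lemma bubble_eq (m : ℕ) (p x : EuclideanSpace ℝ (Fin (m + 3))) :
    bubble (m + 3) p x = bconst m * (1 + ‖x - p‖ ^ 2) ^ (-(((m + 1 : ℕ) : ℝ) / 2)) := by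
  unfold bubble bconst
  congr 3
  push_cast; ring

lemma bubble_nonneg (m : ℕ) (p x : EuclideanSpace ℝ (Fin (m + 3))) :
    0 ≤ bubble (m + 3) p x := by
  rw [bubble_eq]
  have := bconst_pos m
  positivity

lemma bubble_le (m : ℕ) (p x : EuclideanSpace ℝ (Fin (m + 3))) (h : 0 < ‖x - p‖) :
    bubble (m + 3) p x ≤ bconst m * (‖x - p‖ ^ (m + 1))⁻¹ := by
  rw [bubble_eq]
  exact mul_le_mul_of_nonneg_left (rpow_half_le _ _ h) (bconst_pos m).le

lemma grad_le (m : ℕ) (q x : EuclideanSpace ℝ (Fin (m + 3))) (h : 0 < ‖x - q‖) :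
    ‖fderiv ℝ (bubble (m + 3) q) x‖ ≤ bconst m * (m + 1) * (‖x - q‖ ^ (m + 2))⁻¹ := by
  have h0 : HasFDerivAt (fun x => ‖x - q‖ ^ 2)
      (2 • (innerSL ℝ (x - q)).comp (ContinuousLinearMap.id ℝ _)) x :=
    ((hasFDerivAt_id x).sub_const q).norm_sq
  have h1 := ((h0.const_add 1).rpow_const (p := -(((m + 1 : ℕ) : ℝ) / 2))
    (Or.inl (by positivity))).const_mul (bconst m)
  have hf : bubble (m + 3) q = fun x => bconst m *
      (1 + ‖x - q‖ ^ 2) ^ (-(((m + 1 : ℕ) : ℝ) / 2)) := by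
    funext x; exact bubble_eq m q x
  rw [hf, h1.fderiv, norm_smul, norm_smul]
  have hK := bconst_pos m
  have e : -(((m + 1 : ℕ) : ℝ) / 2) - 1 = -(((m + 3 : ℕ) : ℝ) / 2) := by push_cast; ring
  have h2 : ‖2 • (innerSL ℝ (x - q)).comp (ContinuousLinearMap.id ℝ _)‖ ≤ 2 * ‖x - q‖ := by
    rw [ContinuousLinearMap.comp_id, two_smul]
    refine (norm_add_le _ _).trans ?_
    rw [innerSL_apply_norm]; linarith
  have h3 := rpow_half_le (m + 3) _ h
  rw [e, norm_mul, Real.norm_of_nonneg hK.le, norm_neg, Real.norm_of_nonneg (by positivity),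
    Real.norm_of_nonneg (by positivity)]
  calc _ ≤ bconst m * (((m + 1 : ℕ) : ℝ) / 2 * (‖x - q‖ ^ (m + 3))⁻¹ * (2 * ‖x - q‖)) := by
        gcongr
    _ = _ := by
        rw [pow_succ _ (m + 2)]
        push_cast
        field_simp

lemma pointwise (m : ℕ) (r a b R d : ℝ) (hR : 0 < R) (hd : 0 < d) (hr : 0 < r) (ha : 0 < a)
    (hb : 0 < b) (hab : d ≤ a + b) (hra : R ≤ r + a) (hrb : R ≤ r + b) :
    r⁻¹ * (a ^ (m + 2))⁻¹ * (b ^ (m + 1))⁻¹ ≤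
      ((R / 2) ^ (2 * m + 3))⁻¹ * (Set.Iio (R / 2)).indicator (fun t : ℝ => (t ^ 1)⁻¹) r +
      (R / 2)⁻¹ * (
        ((d / 2) ^ (m + 1))⁻¹ * (Set.Iio (d / 2)).indicator (fun t : ℝ => (t ^ (m + 2))⁻¹) a +
        ((d / 2) ^ (m + 2))⁻¹ * (Set.Iio (d / 2)).indicator (fun t : ℝ => (t ^ (m + 1))⁻¹) b +
        (Set.Ici (d / 2)).indicator (fun t : ℝ => (t ^ (2 * m + 3))⁻¹) a +
        (Set.Ici (d / 2)).indicator (fun t : ℝ => (t ^ (2 * m + 3))⁻¹) b) := by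
  have n1 : 0 ≤ (Set.Iio (R / 2)).indicator (fun t : ℝ => (t ^ 1)⁻¹) r := by
    apply Set.indicator_apply_nonneg; intro _; positivity
  have n2 : 0 ≤ (Set.Iio (d / 2)).indicator (fun t : ℝ => (t ^ (m + 2))⁻¹) a := by
    apply Set.indicator_apply_nonneg; intro _; positivity
  have n3 : 0 ≤ (Set.Iio (d / 2)).indicator (fun t : ℝ => (t ^ (m + 1))⁻¹) b := by
    apply Set.indicator_apply_nonneg; intro _; positivity
  have n4 : 0 ≤ (Set.Ici (d / 2)).indicator (fun t : ℝ => (t ^ (2 * m + 3))⁻¹) a := by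
    apply Set.indicator_apply_nonneg; intro _; positivity
  have n5 : 0 ≤ (Set.Ici (d / 2)).indicator (fun t : ℝ => (t ^ (2 * m + 3))⁻¹) b := by
    apply Set.indicator_apply_nonneg; intro _; positivity
  have split : ∀ t : ℝ, (t ^ (2 * m + 3))⁻¹ = (t ^ (m + 2))⁻¹ * (t ^ (m + 1))⁻¹ := by
    intro t
    rw [← mul_inv, ← pow_add]; congr 2; omega
  by_cases h : r < R / 2
  · have ha' : R / 2 ≤ a := by linarith
    have hb' : R / 2 ≤ b := by linarith
    have : r⁻¹ * (a ^ (m + 2))⁻¹ * (b ^ (m + 1))⁻¹ ≤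
        ((R / 2) ^ (2 * m + 3))⁻¹ * (Set.Iio (R / 2)).indicator (fun t : ℝ => (t ^ 1)⁻¹) r := by
      rw [Set.indicator_of_mem (by exact h), split, pow_one]
      calc _ ≤ r⁻¹ * ((R / 2) ^ (m + 2))⁻¹ * ((R / 2) ^ (m + 1))⁻¹ := by gcongr
        _ = _ := by ring
    refine this.trans (le_add_of_nonneg_right ?_)
    positivity
  · refine le_trans ?_ (le_add_of_nonneg_left (by positivity))
    rw [mul_assoc]
    apply mul_le_mul _ _ (by positivity) (by positivity)
    · apply inv_anti₀ (by positivity); linarith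
    have p2 := mul_nonneg (inv_nonneg.2 (by positivity : 0 ≤ (d / 2) ^ (m + 1))) n2
    have p3 := mul_nonneg (inv_nonneg.2 (by positivity : 0 ≤ (d / 2) ^ (m + 2))) n3
    by_cases h1 : a < d / 2
    · have hb' : d / 2 ≤ b := by linarith
      have : (a ^ (m + 2))⁻¹ * (b ^ (m + 1))⁻¹ ≤ ((d / 2) ^ (m + 1))⁻¹ *
          (Set.Iio (d / 2)).indicator (fun t : ℝ => (t ^ (m + 2))⁻¹) a := by
        rw [Set.indicator_of_mem (by exact h1), mul_comm]
        gcongr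
      linarith
    by_cases h2 : b < d / 2
    · have ha' : d / 2 ≤ a := by linarith
      have : (a ^ (m + 2))⁻¹ * (b ^ (m + 1))⁻¹ ≤ ((d / 2) ^ (m + 2))⁻¹ *
          (Set.Iio (d / 2)).indicator (fun t : ℝ => (t ^ (m + 1))⁻¹) b := by
        rw [Set.indicator_of_mem (by exact h2)]
        gcongr
      linarith
    push Not at h1 h2
    rcases le_total a b with h3 | h3
    · have : (a ^ (m + 2))⁻¹ * (b ^ (m + 1))⁻¹ ≤
          (Set.Ici (d / 2)).indicator (fun t : ℝ => (t ^ (2 * m + 3))⁻¹) a := by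
        rw [Set.indicator_of_mem (by exact h1), split]
        gcongr
      linarith
    · have : (a ^ (m + 2))⁻¹ * (b ^ (m + 1))⁻¹ ≤
          (Set.Ici (d / 2)).indicator (fun t : ℝ => (t ^ (2 * m + 3))⁻¹) b := by
        rw [Set.indicator_of_mem (by exact h2), split]
        gcongr
      linarith

lemma final_arith (m : ℕ) (R d V : ℝ) (hR : 0 < R) (hd : 0 < d) (hdR : d ≤ 2 * R) (hV : 0 ≤ V) :
    ((R / 2) ^ (2 * m + 3))⁻¹ * (V * (R / 2) ^ (m + 1 + 1)) +
      (R / 2)⁻¹ * (((d / 2) ^ (m + 1))⁻¹ * (V * (d / 2) ^ (0 + 1)) +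
        ((d / 2) ^ (m + 2))⁻¹ * (V * (d / 2) ^ (1 + 1)) +
        V * ((d / 2) ^ m)⁻¹ + V * ((d / 2) ^ m)⁻¹) ≤ V * 10 * 4 ^ m / (R * d ^ m) := by
  have e1 : ((R / 2) ^ (2 * m + 3))⁻¹ * (V * (R / 2) ^ (m + 1 + 1)) =
      (R / 2)⁻¹ * (V * ((R / 2) ^ m)⁻¹) := by
    have : 2 * m + 3 = (m + 1 + 1) + m + 1 := by omega
    rw [this, pow_succ _ (m + 1 + 1 + m), pow_add _ (m + 1 + 1) m]
    field_simp
  have e2 : ((d / 2) ^ (m + 1))⁻¹ * (V * (d / 2) ^ (0 + 1)) = V * ((d / 2) ^ m)⁻¹ := by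
    rw [pow_succ _ m]; field_simp; ring
  have e3 : ((d / 2) ^ (m + 2))⁻¹ * (V * (d / 2) ^ (1 + 1)) = V * ((d / 2) ^ m)⁻¹ := by
    rw [pow_add _ m]; field_simp; ring
  have i1 : ((R / 2) ^ m)⁻¹ ≤ ((d / 4) ^ m)⁻¹ := by
    gcongr ?_⁻¹; gcongr ?_ ^ m; linarith
  have i2 : ((d / 2) ^ m)⁻¹ ≤ ((d / 4) ^ m)⁻¹ := by
    gcongr ?_⁻¹; gcongr ?_ ^ m; linarith
  rw [e1, e2, e3]
  calc _ ≤ (R / 2)⁻¹ * (V * ((d / 4) ^ m)⁻¹) + (R / 2)⁻¹ * (V * ((d / 4) ^ m)⁻¹ +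
        V * ((d / 4) ^ m)⁻¹ + V * ((d / 4) ^ m)⁻¹ + V * ((d / 4) ^ m)⁻¹) := by gcongr
    _ = _ := by
      rw [div_pow]; field_simp; ring

theorem stmt_10 (N : ℕ) (hN : 4 ≤ N) :
    ∃ C : ℝ, 0 < C ∧ ∀ R : ℝ, 2 ≤ R → ∀ p q : EuclideanSpace ℝ (Fin N),
      ‖p‖ = R → ‖q‖ = R → 2 ≤ ‖p - q‖ →
      (∫ x, (1 / ‖x‖) * ‖fderiv ℝ (bubble N q) x‖ * bubble N p x) ≤
        C / (R * ‖p - q‖ ^ ((N : ℝ) - 3)) := by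
  obtain ⟨m, rfl⟩ : ∃ m, N = m + 3 := ⟨N - 3, by omega⟩
  have hm : 1 ≤ m := by omega
  set V : ℝ := ((m + 3 : ℕ) * (volume : Measure (EuclideanSpace ℝ (Fin (m + 3)))).real (ball 0 1))
    with hVdef
  have hV : 0 ≤ V := by positivity
  have hK := bconst_pos m
  set D : ℝ := bconst m * (m + 1) * bconst m with hD
  have hDpos : 0 < D := by positivity
  refine ⟨D * ((V + 1) * 10 * 4 ^ m), by positivity, ?_⟩
  intro R hR p q hp hq hpq
  have hexp : (((m + 3 : ℕ) : ℝ) - 3) = (m : ℝ) := by push_cast; ring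
  rw [hexp, Real.rpow_natCast]
  set d := ‖p - q‖ with hd
  have hR0 : 0 < R := by linarith
  have hd0 : 0 < d := by linarith
  have hdR : d ≤ 2 * R := by
    have := norm_sub_le p q
    linarith
  obtain ⟨I1, J1⟩ := inner_int m 1 (m + 1) (by omega) (R / 2) (by positivity)
  obtain ⟨I2, J2⟩ := inner_int m (m + 2) 0 (by omega) (d / 2) (by positivity)
  obtain ⟨I3, J3⟩ := inner_int m (m + 1) 1 (by omega) (d / 2) (by positivity)
  obtain ⟨I4, J4⟩ := outer_int m hm (d / 2) (by positivity)
  rw [← hVdef] at J1 J2 J3 J4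
  have I2' := I2.comp_sub_right q
  have I3' := I3.comp_sub_right p
  have I4' := I4.comp_sub_right q
  have I5' := I4.comp_sub_right p
  rw [← integral_sub_right_eq_self _ q] at J2
  rw [← integral_sub_right_eq_self _ p] at J3
  have J5 := J4
  rw [← integral_sub_right_eq_self _ q] at J4
  rw [← integral_sub_right_eq_self _ p] at J5
  have IA := I1.const_mul (((R / 2) ^ (2 * m + 3))⁻¹)
  have IB := I2'.const_mul (((d / 2) ^ (m + 1))⁻¹)
  have IC := I3'.const_mul (((d / 2) ^ (m + 2))⁻¹)
  have hne : ∀ y : EuclideanSpace ℝ (Fin (m + 3)), ∀ᵐ x : EuclideanSpace ℝ (Fin (m + 3)), x ≠ y :=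
    fun y => Measure.ae_ne volume y
  have step1 := integral_mono_of_nonneg (μ := (volume : Measure (EuclideanSpace ℝ (Fin (m + 3)))))
    (f := fun x => (1 / ‖x‖) * ‖fderiv ℝ (bubble (m + 3) q) x‖ * bubble (m + 3) p x)
    (Eventually.of_forall fun x => by
      have := bubble_nonneg m p x
      show 0 ≤ _
      positivity)
    ((IA.add (((IB.add IC).add I4').add I5' |>.const_mul ((R / 2)⁻¹))).const_mul D)
    (by
      filter_upwards [hne 0, hne p, hne q] with x h0 h1 h2
      have r0 : 0 < ‖x‖ := norm_pos_iff.2 h0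
      have a0 : 0 < ‖x - q‖ := norm_pos_iff.2 (sub_ne_zero.2 h2)
      have b0 : 0 < ‖x - p‖ := norm_pos_iff.2 (sub_ne_zero.2 h1)
      have t1 : d ≤ ‖x - q‖ + ‖x - p‖ := by
        have := norm_sub_le (x - q) (x - p)
        rwa [show x - q - (x - p) = p - q by abel] at this
      have t2 : R ≤ ‖x‖ + ‖x - q‖ := by
        have := norm_sub_le x (x - q)
        rwa [show x - (x - q) = q by abel, hq] at this
      have t3 : R ≤ ‖x‖ + ‖x - p‖ := by
        have := norm_sub_le x (x - p)
        rwa [show x - (x - p) = p by abel, hp] at this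
      have P := pointwise m ‖x‖ ‖x - q‖ ‖x - p‖ R d hR0 hd0 r0 a0 b0 t1 t2 t3
      have G := grad_le m q x a0
      have B := bubble_le m p x b0
      have Bn := bubble_nonneg m p x
      calc (1 / ‖x‖) * ‖fderiv ℝ (bubble (m + 3) q) x‖ * bubble (m + 3) p x
          ≤ (1 / ‖x‖) * (bconst m * (m + 1) * (‖x - q‖ ^ (m + 2))⁻¹) *
            (bconst m * (‖x - p‖ ^ (m + 1))⁻¹) := by gcongr
        _ = D * (‖x‖⁻¹ * (‖x - q‖ ^ (m + 2))⁻¹ * (‖x - p‖ ^ (m + 1))⁻¹) := by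
            rw [hD]; ring
        _ ≤ _ := mul_le_mul_of_nonneg_left P hDpos.le)
  refine step1.trans ?_
  rw [integral_const_mul, integral_add' IA
      (((IB.add IC).add I4').add I5' |>.const_mul ((R / 2)⁻¹)), integral_const_mul,
    integral_const_mul]
  rw [integral_add' ((IB.add IC).add I4') I5', integral_add' (IB.add IC) I4', integral_add' IB IC,
    integral_const_mul, integral_const_mul, mul_div_assoc]
  apply mul_le_mul_of_nonneg_left _ hDpos.le
  have F := final_arith m R d V hR0 hd0 hdR hV
  have F2 : V * 10 * 4 ^ m / (R * d ^ m) ≤ (V + 1) * 10 * 4 ^ m / (R * d ^ m) := by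
    gcongr; linarith
  refine le_trans ?_ (F.trans F2)
  gcongr
end

section
/- Let N ≥ 4 and m ∈ ℤ. There exists k₀ ∈ ℕ such that for every integer k ≥ k₀ there exists R₀ > 0 such that for all R ≥ R₀: ∫_{ℝ^N} Re( Σ_{i≠j} |w_i(x)|^{2^*−2} w_i(x) · conj(w_j(x)) ) dx ≥ 0, where the sum runs over ordered pairs i ≠ j in {1, …, k}. -/
open MeasureTheory Complex Filter Metric

/-- the center `x_j = (R cos(2πj/k), R sin(2πj/k), 0, …, 0) ∈ ℝ^N`. -/
noncomputable def center (N k : ℕ) (R : ℝ) (j : ℕ) : EuclideanSpace ℝ (Fin N) :=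
  (EuclideanSpace.equiv (Fin N) ℝ).symm fun i =>
    if (i : ℕ) = 0 then R * Real.cos (2 * Real.pi * j / k)
    else if (i : ℕ) = 1 then R * Real.sin (2 * Real.pi * j / k)
    else 0

/-- the phase-modulated bubble `w_j = e^{2πi j m/k} U_{x_j}`. -/
noncomputable def wfun (N k : ℕ) (m : ℤ) (R : ℝ) (j : ℕ)
    (x : EuclideanSpace ℝ (Fin N)) : ℂ :=
  Complex.exp (2 * Real.pi * Complex.I * j * m / k) * (bubble N (center N k R j) x : ℝ)


/-- `1 + |x-p|^2` -/
noncomputable def brk {N : ℕ} (p x : EuclideanSpace ℝ (Fin N)) : ℝ := 1 + ‖x - p‖ ^ 2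

lemma brk_one_le {N : ℕ} (p x : EuclideanSpace ℝ (Fin N)) : 1 ≤ brk p x := by
  unfold brk; nlinarith [sq_nonneg ‖x - p‖]

lemma brk_pos {N : ℕ} (p x : EuclideanSpace ℝ (Fin N)) : 0 < brk p x :=
  lt_of_lt_of_le one_pos (brk_one_le p x)

lemma brk_cont {N : ℕ} (p : EuclideanSpace ℝ (Fin N)) (s : ℝ) :
    Continuous (fun x => brk p x ^ s) := by
  refine Continuous.rpow_const ?_ (fun x => Or.inl (brk_pos p x).ne')
  unfold brk; fun_prop

lemma brk_integrable {N : ℕ} (p : EuclideanSpace ℝ (Fin N)) (r : ℝ) (hr : (N : ℝ) < r) :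
    Integrable (fun x => brk p x ^ (-r / 2)) := by
  have h := integrable_rpow_neg_one_add_norm_sq (E := EuclideanSpace ℝ (Fin N))
    (μ := volume) (r := r) (by simpa using hr)
  exact h.comp_sub_right p

lemma brk_integral {N : ℕ} (p : EuclideanSpace ℝ (Fin N)) (s : ℝ) :
    ∫ x, brk p x ^ s = ∫ x, brk (0 : EuclideanSpace ℝ (Fin N)) x ^ s := by
  have := integral_sub_right_eq_self (μ := (volume : Measure (EuclideanSpace ℝ (Fin N))))
    (fun x => brk 0 x ^ s) p
  rw [← this]
  simp [brk]

lemma brk_peetre {N : ℕ} (p q x : EuclideanSpace ℝ (Fin N)) :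
    brk q x ≤ 2 * (brk p x * brk q p) := by
  have h : ‖x - q‖ ≤ ‖x - p‖ + ‖p - q‖ := norm_sub_le_norm_sub_add_norm_sub x p q
  unfold brk
  have := norm_nonneg (x - q)
  nlinarith [sq_nonneg (‖x - p‖ - ‖p - q‖), sq_nonneg (‖x - p‖ * ‖p - q‖)]

lemma brk_tri {N : ℕ} (p q x : EuclideanSpace ℝ (Fin N)) :
    brk q p ≤ 2 * (brk p x + brk q x) := by
  have h : ‖p - q‖ ≤ ‖x - p‖ + ‖x - q‖ := by
    rw [norm_sub_rev x p]; exact norm_sub_le_norm_sub_add_norm_sub p x q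
  unfold brk
  have := norm_nonneg (p - q)
  nlinarith [sq_nonneg (‖x - p‖ - ‖x - q‖)]

lemma pt_upper {n : ℝ} (hn : 4 ≤ n) {A B D : ℝ} (hA : 1 ≤ A) (hB : 1 ≤ B) (hD : 0 < D)
    (h : D ≤ 2 * (A + B)) :
    A ^ (-(n + 2) / 2) * B ^ (-(n - 2) / 2) ≤
      (D / 4) ^ (-(n - 2) / 2) * (A ^ (-(n + 1) / 2) + B ^ (-(n + 1) / 2)) := by
  have hA0 : 0 < A := by linarith
  have hB0 : 0 < B := by linarith
  have hD4 : 0 < D / 4 := by linarith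
  rcases le_total A B with hab | hab
  · have h1 : B ^ (-(n - 2) / 2) ≤ (D / 4) ^ (-(n - 2) / 2) :=
      Real.rpow_le_rpow_of_nonpos hD4 (by linarith) (by linarith)
    have h2 : A ^ (-(n + 2) / 2) ≤ A ^ (-(n + 1) / 2) :=
      Real.rpow_le_rpow_of_exponent_le hA (by linarith)
    have h3 : 0 ≤ B ^ (-(n + 1) / 2) := by positivity
    rw [mul_comm]
    apply mul_le_mul h1 (by linarith) (by positivity) (by positivity)
  · have h1 : A ^ (-(n - 2) / 2) ≤ (D / 4) ^ (-(n - 2) / 2) :=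
      Real.rpow_le_rpow_of_nonpos hD4 (by linarith) (by linarith)
    have h2 : A ^ (-(n + 2) / 2) * B ^ (-(n - 2) / 2) ≤
        A ^ (-(n - 2) / 2) * B ^ (-(n + 1) / 2) := by
      have e1 : A ^ (-(n + 2) / 2) = A ^ (-(n - 2) / 2) * A ^ (-2 : ℝ) := by
        rw [← Real.rpow_add hA0]; ring_nf
      have e2 : B ^ (-(n - 2) / 2) = B ^ (3 / 2 : ℝ) * B ^ (-(n + 1) / 2) := by
        rw [← Real.rpow_add hB0]; ring_nf
      have e3 : A ^ (-2 : ℝ) * B ^ (3 / 2 : ℝ) ≤ 1 := by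
        calc A ^ (-2 : ℝ) * B ^ (3 / 2 : ℝ) ≤ A ^ (-2 : ℝ) * A ^ (3 / 2 : ℝ) := by
              gcongr
          _ = A ^ (-1 / 2 : ℝ) := by rw [← Real.rpow_add hA0]; norm_num
          _ ≤ 1 := Real.rpow_le_one_of_one_le_of_nonpos hA (by norm_num)
      rw [e1, e2]
      calc _ = (A ^ (-(n - 2) / 2) * B ^ (-(n + 1) / 2)) * (A ^ (-2 : ℝ) * B ^ (3 / 2 : ℝ)) := by ring
        _ ≤ (A ^ (-(n - 2) / 2) * B ^ (-(n + 1) / 2)) * 1 := by gcongr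
        _ = _ := by ring
    have h3 : 0 ≤ A ^ (-(n + 1) / 2) := by positivity
    refine h2.trans (mul_le_mul h1 (by linarith) (by positivity) (by positivity))

/-- The interaction kernel. -/
noncomputable def ikern {N : ℕ} (p q x : EuclideanSpace ℝ (Fin N)) : ℝ :=
  brk p x ^ (-((N : ℝ) + 2) / 2) * brk q x ^ (-((N : ℝ) - 2) / 2)

lemma ker_bounds (N : ℕ) (hN : 4 ≤ N) : ∃ c1 c2 : ℝ, 0 < c1 ∧ 0 < c2 ∧
    ∀ p q : EuclideanSpace ℝ (Fin N), Integrable (ikern p q) ∧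
      c1 * brk q p ^ (-((N : ℝ) - 2) / 2) ≤ ∫ x, ikern p q x ∧
      ∫ x, ikern p q x ≤ c2 * brk q p ^ (-((N : ℝ) - 2) / 2) := by
  have hn : (4 : ℝ) ≤ N := by exact_mod_cast hN
  set n : ℝ := (N : ℝ) with hndef
  let J : ℝ → ℝ := fun r => ∫ x, brk (0 : EuclideanSpace ℝ (Fin N)) x ^ (-r / 2)
  have Jpos : ∀ r, n < r → 0 < J r := by
    intro r hr
    refine integral_pos_of_integrable_nonneg_nonzero (x := 0) (brk_cont _ _)
      (brk_integrable _ _ hr) (fun x => (Real.rpow_pos_of_pos (brk_pos _ _) _).le)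
      (Real.rpow_pos_of_pos (brk_pos _ _) _).ne'
  refine ⟨2 ^ (-(n - 2) / 2) * J (2 * n), (1 / 4) ^ (-(n - 2) / 2) * (J (n + 1) + J (n + 1)),
    mul_pos (by positivity) (Jpos _ (by linarith)),
    mul_pos (by positivity) (add_pos (Jpos _ (by linarith)) (Jpos _ (by linarith))), ?_⟩
  intro p q
  have hub : Integrable (fun x => (brk q p / 4) ^ (-(n - 2) / 2) *
      (brk p x ^ (-(n + 1) / 2) + brk q x ^ (-(n + 1) / 2))) :=
    ((brk_integrable p _ (by linarith)).add (brk_integrable q _ (by linarith))).const_mul _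
  have hpt : ∀ x, ikern p q x ≤ (brk q p / 4) ^ (-(n - 2) / 2) *
      (brk p x ^ (-(n + 1) / 2) + brk q x ^ (-(n + 1) / 2)) := fun x =>
    pt_upper hn (brk_one_le p x) (brk_one_le q x) (brk_pos q p) (brk_tri p q x)
  have hk0 : ∀ x, 0 ≤ ikern p q x := fun x =>
    mul_nonneg (Real.rpow_nonneg (brk_pos _ _).le _) (Real.rpow_nonneg (brk_pos _ _).le _)
  have hint : Integrable (ikern p q) := by
    refine hub.mono' ((brk_cont p _).mul (brk_cont q _)).aestronglyMeasurable ?_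
    filter_upwards with x
    rw [Real.norm_of_nonneg (hk0 x)]
    exact hpt x
  refine ⟨hint, ?_, ?_⟩
  · have hle : ∀ x, (2 * brk q p) ^ (-(n - 2) / 2) * brk p x ^ (-(2 * n) / 2) ≤ ikern p q x := by
      intro x
      have hA := brk_pos p x
      have hD := brk_pos q p
      have e : brk p x ^ (-(2 * n) / 2) = brk p x ^ (-(n + 2) / 2) * brk p x ^ (-(n - 2) / 2) := by
        rw [← Real.rpow_add hA]; ring_nf
      have h2 : (2 * brk q p * brk p x) ^ (-(n - 2) / 2) ≤ brk q x ^ (-(n - 2) / 2) :=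
        Real.rpow_le_rpow_of_nonpos (brk_pos q x) (by linarith [brk_peetre p q x]) (by linarith)
      rw [Real.mul_rpow (by positivity) hA.le] at h2
      unfold ikern
      rw [e]
      calc _ = brk p x ^ (-(n + 2) / 2) *
            ((2 * brk q p) ^ (-(n - 2) / 2) * brk p x ^ (-(n - 2) / 2)) := by ring
        _ ≤ _ := mul_le_mul_of_nonneg_left h2 (by positivity)
    have := integral_mono ((brk_integrable p (2 * n) (by linarith)).const_mul _) hint hle
    rw [integral_const_mul, brk_integral, Real.mul_rpow (by norm_num) (brk_pos q p).le] at this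
    refine le_trans (le_of_eq ?_) this
    simp only [J]; ring
  · have := integral_mono hint hub hpt
    rw [integral_const_mul, integral_add (brk_integrable p _ (by linarith))
      (brk_integrable q _ (by linarith)), brk_integral p, brk_integral q] at this
    refine this.trans (le_of_eq ?_)
    rw [div_eq_mul_one_div, Real.mul_rpow (brk_pos q p).le (by norm_num)]
    simp only [J]; ring

lemma abs_sin_nat (m : ℕ) (t : ℝ) : |Real.sin (m * t)| ≤ m * |Real.sin t| := by
  induction m with
  | zero => simp
  | succ m ih =>
    push_cast
    rw [add_mul, one_mul, Real.sin_add]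
    refine (abs_add_le _ _).trans ?_
    rw [abs_mul, abs_mul]
    have h1 := Real.abs_cos_le_one t
    have h2 := Real.abs_cos_le_one (m * t)
    nlinarith [abs_nonneg (Real.sin t), abs_nonneg (Real.sin (m * t))]

lemma sin_int_sq (m : ℤ) (t : ℝ) : Real.sin (m * t) ^ 2 ≤ (m : ℝ) ^ 2 * Real.sin t ^ 2 := by
  have h := abs_sin_nat m.natAbs t
  have h2 := pow_le_pow_left₀ (abs_nonneg _) h 2
  rw [mul_pow, sq_abs, sq_abs] at h2
  rcases Int.natAbs_eq m with e | e
  · rw [e]; simpa using h2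
  · rw [e]; push_cast; simpa [neg_mul, Real.sin_neg] using h2

lemma cos_lower (m : ℤ) (t : ℝ) : 1 - 2 * (m : ℝ) ^ 2 * Real.sin t ^ 2 ≤ Real.cos (2 * (m * t)) := by
  have := sin_int_sq m t
  rw [Real.cos_two_mul, Real.cos_sq']
  linarith

lemma brk_center (N k : ℕ) (hN : 4 ≤ N) (R : ℝ) (i j : ℕ) :
    brk (center N k R j) (center N k R i) =
      1 + 4 * R ^ 2 * Real.sin (Real.pi * ((i : ℝ) - j) / k) ^ 2 := by
  obtain ⟨n, rfl⟩ : ∃ n, N = n + 2 := ⟨N - 2, by omega⟩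
  unfold brk
  rw [EuclideanSpace.norm_sq_eq, Fin.sum_univ_succ, Fin.sum_univ_succ]
  simp [center]
  have h1 : Real.cos (2 * Real.pi * i / k - 2 * Real.pi * j / k) =
      1 - 2 * Real.sin (Real.pi * ((i : ℝ) - j) / k) ^ 2 := by
    rw [← Real.cos_two_mul_eq_one_sub]
    ring_nf
  rw [Real.cos_sub] at h1
  have h2 := Real.sin_sq_add_cos_sq (2 * Real.pi * i / k)
  have h3 := Real.sin_sq_add_cos_sq (2 * Real.pi * j / k)
  linear_combination R ^ 2 * (h2 + h3 - 2 * h1)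

lemma term_re (N : ℕ) (hN : 4 ≤ N) : ∃ K : ℝ, 0 < K ∧ ∀ (k : ℕ) (m : ℤ) (R : ℝ) (i j : ℕ)
    (x : EuclideanSpace ℝ (Fin N)),
    (((‖wfun N k m R i x‖ ^ ((2 * (N : ℝ)) / ((N : ℝ) - 2) - 2) : ℝ) : ℂ) *
            wfun N k m R i x * (starRingEnd ℂ) (wfun N k m R j x)).re =
      K * Real.cos (2 * (m * (Real.pi * ((i : ℝ) - j) / k))) *
        ikern (center N k R i) (center N k R j) x := by
  have hn : (4 : ℝ) ≤ N := by exact_mod_cast hN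
  set c : ℝ := ((N : ℝ) * ((N : ℝ) - 2)) ^ (((N : ℝ) - 2) / 4) with hc
  have hc0 : 0 < c := by
    apply Real.rpow_pos_of_pos; nlinarith
  refine ⟨c ^ ((2 * (N : ℝ)) / ((N : ℝ) - 2) - 2) * c * c, by positivity, ?_⟩
  intro k m R i j x
  have hb : ∀ p : EuclideanSpace ℝ (Fin N), bubble N p x = c * brk p x ^ (-((N : ℝ) - 2) / 2) := by
    intro p; unfold bubble brk; rw [neg_div]
  have hb0 : ∀ p : EuclideanSpace ℝ (Fin N), 0 < bubble N p x := by
    intro p; rw [hb]; exact mul_pos hc0 (Real.rpow_pos_of_pos (brk_pos _ _) _)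
  have hw : ∀ l : ℕ, wfun N k m R l x = Complex.exp ((2 * Real.pi * l * m / k : ℝ) * Complex.I) *
      (bubble N (center N k R l) x : ℝ) := by
    intro l; unfold wfun; push_cast; ring_nf
  have hnorm : ‖wfun N k m R i x‖ = bubble N (center N k R i) x := by
    rw [hw, norm_mul, Complex.norm_exp_ofReal_mul_I, one_mul, Complex.norm_real,
      Real.norm_of_nonneg (hb0 _).le]
  have hpow : bubble N (center N k R i) x ^ ((2 * (N : ℝ)) / ((N : ℝ) - 2) - 2) *
      bubble N (center N k R i) x * bubble N (center N k R j) x =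
      c ^ ((2 * (N : ℝ)) / ((N : ℝ) - 2) - 2) * c * c *
        ikern (center N k R i) (center N k R j) x := by
    have hA := brk_pos (center N k R i) x
    have e : brk (center N k R i) x ^ (-((N : ℝ) + 2) / 2) =
        (brk (center N k R i) x ^ (-((N : ℝ) - 2) / 2)) ^ ((2 * (N : ℝ)) / ((N : ℝ) - 2) - 2) *
        brk (center N k R i) x ^ (-((N : ℝ) - 2) / 2) := by
      rw [← Real.rpow_mul hA.le, ← Real.rpow_add hA]
      congr 1
      have : (N : ℝ) - 2 ≠ 0 := by linarith
      field_simp; ring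
    rw [hb, hb, Real.mul_rpow hc0.le (by positivity), ikern, e]
    ring
  rw [hnorm, hw, hw, mul_right_comm _ _ (ikern _ _ _), ← hpow]
  set b1 := bubble N (center N k R i) x
  set b2 := bubble N (center N k R j) x
  have hcos : Real.cos (2 * (m * (Real.pi * ((i : ℝ) - j) / k))) =
    Real.cos (2 * Real.pi * i * m / k - 2 * Real.pi * j * m / k) := by ring_nf
  rw [hcos, Real.cos_sub]
  rw [Complex.exp_mul_I, Complex.exp_mul_I, ← Complex.ofReal_cos, ← Complex.ofReal_sin,
    ← Complex.ofReal_cos, ← Complex.ofReal_sin]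
  simp [-Complex.ofReal_cos, -Complex.ofReal_sin, -ofReal_div, -ofReal_mul]
  ring

set_option maxHeartbeats 1000000 in
/-- nonnegativity of the interaction term
`α = ∫ Re( Σ_{i≠j} |w_i|^{2^*−2} w_i conj(w_j) )` for `k` and then `R` large enough. -/
theorem stmt_12 (N : ℕ) (hN : 4 ≤ N) (m : ℤ) :
    ∃ k₀ : ℕ, ∀ k : ℕ, k₀ ≤ k → ∃ R₀ : ℝ, 0 < R₀ ∧ ∀ R : ℝ, R₀ ≤ R →
      0 ≤ ∫ x, (∑ i ∈ Finset.Icc 1 k, ∑ j ∈ Finset.Icc 1 k,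
        if i ≠ j then
          ((‖wfun N k m R i x‖ ^ ((2 * (N : ℝ)) / ((N : ℝ) - 2) - 2) : ℝ) : ℂ) *
            wfun N k m R i x * (starRingEnd ℂ) (wfun N k m R j x)
        else 0).re := by
  obtain ⟨K, hK, hterm⟩ := term_re N hN
  obtain ⟨c1, c2, hc1, hc2, hker⟩ := ker_bounds N hN
  have hn : (4 : ℝ) ≤ N := by exact_mod_cast hN
  set e : ℝ := -((N : ℝ) - 2) / 2 with he
  have he1 : e ≤ -1 := by rw [he]; linarith
  set L : ℝ := 1 + 4 * Real.pi ^ 2 with hL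
  have hL0 : 0 < L := by positivity
  set μ : ℝ := 2 / ((m : ℝ) ^ 2 + 1) with hμ
  have hμ0 : 0 < μ := by positivity
  set a1 : ℝ := 1 / 2 * (c1 * L ^ e) with ha1
  have ha10 : 0 < a1 := by positivity
  set a2 : ℝ := c2 * μ ^ e with ha2
  have ha20 : 0 < a2 := by positivity
  obtain ⟨k₀, hk₀⟩ := exists_nat_ge (a2 / a1 + 2 + 2 * |(m : ℝ)| * Real.pi)
  refine ⟨k₀, fun k hk => ⟨k, ?_, ?_⟩⟩
  · have : (k₀ : ℝ) ≤ k := by exact_mod_cast hk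
    have : 0 < a2 / a1 := by positivity
    have : 0 ≤ 2 * |(m : ℝ)| * Real.pi := by positivity
    linarith
  intro R hR
  have hkk : (k₀ : ℝ) ≤ k := by exact_mod_cast hk
  have hq1 : 0 < a2 / a1 := by positivity
  have hq2 : 0 ≤ 2 * |(m : ℝ)| * Real.pi := by positivity
  have hk2 : (2 : ℝ) ≤ k := by linarith
  have hk2' : 2 ≤ k := by exact_mod_cast hk2
  have hk0 : (0 : ℝ) < k := by linarith
  have hR0 : 0 < R := by linarith
  have hka : a2 ≤ a1 * k := by
    have : a2 / a1 ≤ k := by linarith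
    rwa [div_le_iff₀ ha10, mul_comm] at this
  have hkm : 4 * (m : ℝ) ^ 2 * Real.pi ^ 2 ≤ k ^ 2 := by
    have : 2 * |(m : ℝ)| * Real.pi ≤ k := by linarith
    have := pow_le_pow_left₀ hq2 this 2
    rw [mul_pow, mul_pow, sq_abs] at this
    linarith
  set F : ℕ → ℕ → ℝ := fun i j => if i ≠ j then
    K * Real.cos (2 * (m * (Real.pi * ((i : ℝ) - j) / k))) else 0 with hF
  have hrw : ∀ x, (∑ i ∈ Finset.Icc 1 k, ∑ j ∈ Finset.Icc 1 k,
        if i ≠ j then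
          ((‖wfun N k m R i x‖ ^ ((2 * (N : ℝ)) / ((N : ℝ) - 2) - 2) : ℝ) : ℂ) *
            wfun N k m R i x * (starRingEnd ℂ) (wfun N k m R j x)
        else 0).re = ∑ i ∈ Finset.Icc 1 k, ∑ j ∈ Finset.Icc 1 k,
          F i j * ikern (center N k R i) (center N k R j) x := by
    intro x
    rw [Complex.re_sum]
    refine Finset.sum_congr rfl fun i _ => ?_
    rw [Complex.re_sum]
    refine Finset.sum_congr rfl fun j _ => ?_
    by_cases hij : i = j
    · simp [hF, hij]
    · simp only [hF, ne_eq, hij, not_false_eq_true, if_true]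
      exact hterm k m R i j x
  simp_rw [hrw]
  rw [integral_finsetSum _ (fun i _ => integrable_finsetSum _ fun j _ => (hker _ _).1.const_mul _)]
  refine Finset.sum_nonneg fun i hi => ?_
  rw [integral_finsetSum _ (fun j _ => (hker _ _).1.const_mul _)]
  simp_rw [integral_const_mul]
  set Q : ℝ := (R ^ 2) ^ e with hQ
  have hQ0 : 0 < Q := by positivity
  -- every term is bounded below
  have hlow : ∀ j, -(K * a2 * Q) ≤ F i j * ∫ x, ikern (center N k R i) (center N k R j) x := by
    intro j
    obtain ⟨-, hl, hu⟩ := hker (center N k R i) (center N k R j)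
    have hD := brk_pos (center N k R j) (center N k R i)
    have hI0 : 0 ≤ ∫ x, ikern (center N k R i) (center N k R j) x := le_trans (by positivity) hl
    have hneg : -(K * a2 * Q) ≤ 0 := by
      have : 0 < K * a2 * Q := by positivity
      linarith
    by_cases hij : i = j
    · simp only [hF, ne_eq, hij, not_true_eq_false, if_false, zero_mul]; exact hneg
    simp only [hF, ne_eq, hij, not_false_eq_true, if_true]
    set t := Real.pi * ((i : ℝ) - j) / k with ht
    rcases le_or_gt 0 (Real.cos (2 * (m * t))) with hcos | hcos
    · exact hneg.trans (by positivity)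
    have hs := cos_lower m t
    have hs1 : 1 ≤ 2 * ((m : ℝ) ^ 2 + 1) * Real.sin t ^ 2 := by
      nlinarith [sq_nonneg (Real.sin t)]
    have hDge : μ * R ^ 2 ≤ brk (center N k R j) (center N k R i) := by
      rw [brk_center N k hN, ← ht, hμ, div_mul_eq_mul_div, div_le_iff₀ (by positivity)]
      nlinarith [sq_nonneg R, sq_nonneg (m : ℝ), mul_le_mul_of_nonneg_left hs1 (sq_nonneg R)]
    have hDe : brk (center N k R j) (center N k R i) ^ e ≤ μ ^ e * Q := by
      rw [hQ, ← Real.mul_rpow hμ0.le (by positivity)]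
      exact Real.rpow_le_rpow_of_nonpos (by positivity) hDge (by linarith)
    have hI : ∫ x, ikern (center N k R i) (center N k R j) x ≤ a2 * Q := by
      rw [ha2, mul_assoc]
      exact hu.trans (mul_le_mul_of_nonneg_left hDe hc2.le)
    have h1 := Real.neg_one_le_cos (2 * (m * t))
    have h2 : -(a2 * Q) ≤ Real.cos (2 * (m * t)) *
        ∫ x, ikern (center N k R i) (center N k R j) x := by nlinarith
    have h3 := mul_le_mul_of_nonneg_left h2 hK.le
    refine le_trans (le_of_eq ?_) (h3.trans (le_of_eq ?_)) <;> ring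
  -- a neighbour
  obtain ⟨hi1, hi2⟩ := Finset.mem_Icc.mp hi
  obtain ⟨j, hj, hij, hdist⟩ : ∃ j ∈ Finset.Icc 1 k, i ≠ j ∧ ((i : ℝ) - j) ^ 2 = 1 := by
    rcases Nat.lt_or_ge i k with h | h
    · exact ⟨i + 1, by simp; omega, by omega, by push_cast; ring⟩
    · exact ⟨i - 1, by simp; omega, by omega, by rw [Nat.cast_sub hi1]; push_cast; ring⟩
  have hmain : K * a1 * k ^ 2 * Q ≤ F i j * ∫ x, ikern (center N k R i) (center N k R j) x := by
    obtain ⟨-, hl, hu⟩ := hker (center N k R i) (center N k R j)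
    have hD := brk_pos (center N k R j) (center N k R i)
    simp only [hF, ne_eq, hij, not_false_eq_true, if_true]
    set t := Real.pi * ((i : ℝ) - j) / k with ht
    have hs := cos_lower m t
    have ht2 : t ^ 2 = Real.pi ^ 2 / k ^ 2 := by
      rw [ht, div_pow, mul_pow, hdist, mul_one]
    have hst : Real.sin t ^ 2 ≤ Real.pi ^ 2 / k ^ 2 := by
      rw [← ht2]; exact sq_le_sq.mpr Real.abs_sin_le_abs
    have hcos : 1 / 2 ≤ Real.cos (2 * (m * t)) := by
      have h1 : (m : ℝ) ^ 2 * Real.sin t ^ 2 ≤ m ^ 2 * (Real.pi ^ 2 / k ^ 2) :=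
        mul_le_mul_of_nonneg_left hst (sq_nonneg _)
      have h2 : (m : ℝ) ^ 2 * (Real.pi ^ 2 / k ^ 2) ≤ 1 / 4 := by
        rw [← mul_div_assoc, div_le_iff₀ (by positivity)]; linarith
      linarith
    have hDle : brk (center N k R j) (center N k R i) ≤ L * (R ^ 2 * ((k : ℝ) ^ 2)⁻¹) := by
      rw [brk_center N k hN, ← ht, hL]
      have h1 : 1 ≤ R ^ 2 * ((k : ℝ) ^ 2)⁻¹ := by
        rw [← div_eq_mul_inv, one_le_div (by positivity)]
        exact pow_le_pow_left₀ hk0.le hR 2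
      have h2 := mul_le_mul_of_nonneg_left hst (sq_nonneg R)
      rw [div_eq_mul_inv] at h2
      nlinarith
    have hke : (k : ℝ) ^ 2 ≤ (((k : ℝ) ^ 2)⁻¹) ^ e := by
      rw [Real.inv_rpow (by positivity), ← Real.rpow_neg (by positivity)]
      calc (k : ℝ) ^ 2 = ((k : ℝ) ^ 2) ^ (1 : ℝ) := (Real.rpow_one _).symm
        _ ≤ _ := Real.rpow_le_rpow_of_exponent_le (by nlinarith) (by linarith)
    have hDe : L ^ e * (Q * k ^ 2) ≤ brk (center N k R j) (center N k R i) ^ e := by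
      refine le_trans ?_ (Real.rpow_le_rpow_of_nonpos hD hDle (by linarith))
      rw [Real.mul_rpow hL0.le (by positivity), Real.mul_rpow (by positivity) (by positivity)]
      gcongr
    have hI : c1 * (L ^ e * (Q * k ^ 2)) ≤ ∫ x, ikern (center N k R i) (center N k R j) x :=
      le_trans (mul_le_mul_of_nonneg_left hDe hc1.le) hl
    have h2 := mul_le_mul hcos hI (by positivity) (by linarith)
    have h3 := mul_le_mul_of_nonneg_left h2 hK.le
    rw [ha1]
    refine le_trans (le_of_eq ?_) (h3.trans (le_of_eq ?_)) <;> ring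
  have hsum := Finset.single_le_sum (s := Finset.Icc 1 k)
    (f := fun j => F i j * (∫ x, ikern (center N k R i) (center N k R j) x) + K * a2 * Q)
    (fun j _ => by linarith [hlow j]) hj
  rw [Finset.sum_add_distrib, Finset.sum_const, Nat.card_Icc, nsmul_eq_mul] at hsum
  simp only [Nat.add_sub_cancel] at hsum
  have hp : 0 ≤ K * a2 * Q := by positivity
  have hfin : (k : ℝ) * (K * a2 * Q) ≤ K * a1 * k ^ 2 * Q := by
    have := mul_le_mul_of_nonneg_left hka (show 0 ≤ k * K * Q by positivity)
    nlinarith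
  linarith
end

section
/- Let N ≥ 4 and m ∈ ℤ, let A : S^{N−1} → ℝ^N be bounded and measurable, and let a ∈ ℝ be a constant with |a| < (N−2)²/4. Then there exist an integer k ≥ 2 and R > 0 such that the magnetic Rayleigh quotient of the test function Σ_{j=1}^{k} w_j satisfies Q_{A,a}(Σ_{j=1}^{k} w_j) < k^{2/N} · S · ( ∫_{ℝ^N} |Σ_{j=1}^{k} w_j(x)|^{2^*} dx )^{2/2^*}. -/
open MeasureTheory Complex Filter Metric

/-- `Q_{A,a}` with constant electric potential `a`. -/
noncomputable def Qconst (N : ℕ) (A : EuclideanSpace ℝ (Fin N) → EuclideanSpace ℝ (Fin N))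
    (a : ℝ) (u : EuclideanSpace ℝ (Fin N) → ℂ) : ℝ :=
  (∫ x, magGrad2 N A u x) - a * ∫ x, ‖u x‖ ^ 2 / ‖x‖ ^ 2

noncomputable def lpDen (N : ℕ) (u : EuclideanSpace ℝ (Fin N) → ℂ) : ℝ :=
  (∫ x, ‖u x‖ ^ ((2 * (N : ℝ)) / ((N : ℝ) - 2))) ^ (((N : ℝ) - 2) / (N : ℝ))

/-- the best Sobolev constant `S` for `D^{1,2}(ℝ^N) ↪ L^{2^*}(ℝ^N)`. -/
noncomputable def SobolevS (N : ℕ) : ℝ :=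
  sInf { r : ℝ | ∃ u : EuclideanSpace ℝ (Fin N) → ℂ, ContDiff ℝ (⊤ : ℕ∞) u ∧ HasCompactSupport u ∧
    u ≠ 0 ∧ r = (∫ x, grad2 N u x) / lpDen N u }

lemma fderiv_sq_le_grad2 (N : ℕ) (u : EuclideanSpace ℝ (Fin N) → ℂ) (x : EuclideanSpace ℝ (Fin N)) :
    ‖fderiv ℝ u x‖ ^ 2 ≤ grad2 N u x := by
  set L := fderiv ℝ u x with hL
  have hnn : 0 ≤ grad2 N u x := by unfold grad2; positivity
  have h : ‖L‖ ≤ Real.sqrt (grad2 N u x) := by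
    refine L.opNorm_le_bound (Real.sqrt_nonneg _) fun v => ?_
    have hv : v = ∑ j, v j • EuclideanSpace.single j (1:ℝ) := by
      ext i
      simp [Finset.sum_apply, Pi.single_apply]
    have h1 : ‖L v‖ ≤ ∑ j, ‖L (EuclideanSpace.single j 1)‖ * |v j| := by
      conv_lhs => rw [hv, map_sum]
      refine (norm_sum_le _ _).trans (Finset.sum_le_sum fun j _ => ?_)
      rw [map_smul, norm_smul, mul_comm, Real.norm_eq_abs]
    refine h1.trans ?_
    have h2 := Finset.sum_mul_sq_le_sq_mul_sq Finset.univ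
      (fun j => ‖L (EuclideanSpace.single j 1)‖) (fun j => |v j|)
    have h3 : (∑ j, |v j| ^ 2) = ‖v‖ ^ 2 := by
      rw [EuclideanSpace.norm_sq_eq]; simp
    rw [h3] at h2
    have h4 := Real.sqrt_le_sqrt h2
    rw [Real.sqrt_sq (by positivity), Real.sqrt_mul (by positivity), Real.sqrt_sq (norm_nonneg _)] at h4
    exact h4
  calc ‖L‖ ^ 2 ≤ Real.sqrt (grad2 N u x) ^ 2 := by gcongr
    _ = _ := Real.sq_sqrt hnn

lemma sobolev_pos (N : ℕ) (hN : 4 ≤ N) : 0 < SobolevS N := by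
  have hN' : (4:ℝ) ≤ N := by exact_mod_cast hN
  set q : ℝ := (2 * (N : ℝ)) / ((N : ℝ) - 2) with hq
  have hqpos : 0 < q := by apply div_pos <;> linarith
  set p' : NNReal := ⟨q, hqpos.le⟩ with hp'
  set C : NNReal := SNormLESNormFDerivOfEqConst ℂ (volume : Measure (EuclideanSpace ℝ (Fin N))) ((2:NNReal):ℝ) with hC
  have key : ∀ u : EuclideanSpace ℝ (Fin N) → ℂ, ContDiff ℝ (⊤ : ℕ∞) u → HasCompactSupport u →
      u ≠ 0 → 0 < lpDen N u ∧ lpDen N u ≤ (C:ℝ)^2 * ∫ x, grad2 N u x := by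
    intro u hu hs hne
    have hcont := hu.continuous
    have hu1 : ContDiff ℝ 1 u := hu.of_le (by exact_mod_cast le_top)
    have hdc : Continuous (fderiv ℝ u) := hu1.continuous_fderiv (by norm_num)
    have hds : HasCompactSupport (fderiv ℝ u) := hs.fderiv ℝ
    have hqc : Continuous (fun x => ‖u x‖ ^ q) := hcont.norm.rpow_const (fun x => Or.inr hqpos.le)
    have hqs : HasCompactSupport (fun x => ‖u x‖ ^ q) :=
      hs.comp_left (g := fun z : ℂ => ‖z‖ ^ q) (by simp [hqpos.ne'])
    have hpos : 0 < ∫ x, ‖u x‖ ^ q := by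
      obtain ⟨x, hx⟩ := Function.ne_iff.1 hne
      refine hqc.integral_pos_of_hasCompactSupport_nonneg_nonzero hqs (fun x => by positivity) (x := x) ?_
      have : 0 < ‖u x‖ := norm_pos_iff.2 hx
      positivity
    have hmu : MemLp u p' := hcont.memLp_of_hasCompactSupport hs
    have hmd : MemLp (fderiv ℝ u) 2 := hdc.memLp_of_hasCompactSupport hds
    have hgs := eLpNorm_le_eLpNorm_fderiv_of_eq (volume : Measure (EuclideanSpace ℝ (Fin N))) hu1 hs
      (p := 2) (p' := p') (by norm_num) (by simp; omega) (by
        have h2 : (N:ℝ) ≠ 0 := by linarith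
        have h3 : (N:ℝ) - 2 ≠ 0 := by linarith
        rw [show (p' : ℝ) = q from rfl, hq]
        simp
        field_simp)
    have hp0 : (p' : ENNReal) ≠ 0 := by
      simp only [ne_eq, ENNReal.coe_eq_zero]
      intro h; apply hqpos.ne'; exact congrArg NNReal.toReal h
    rw [MemLp.eLpNorm_eq_integral_rpow_norm hp0 (by simp) hmu, ← hC] at hgs
    rw [show ((2:NNReal):ENNReal) = 2 by norm_cast, MemLp.eLpNorm_eq_integral_rpow_norm (by norm_num) (by simp) hmd] at hgs
    have hI2 : 0 ≤ ∫ x, ‖fderiv ℝ u x‖ ^ 2 := integral_nonneg fun x => by positivity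
    have h5 : (∫ x, ‖u x‖ ^ q) ^ q⁻¹ ≤ C * (∫ x, ‖fderiv ℝ u x‖ ^ 2) ^ (2:ℝ)⁻¹ := by
      rw [← ENNReal.ofReal_coe_nnreal (p := C), ← ENNReal.ofReal_mul (by positivity), ENNReal.ofReal_le_ofReal_iff (by simp at hI2 ⊢; positivity)] at hgs
      have hpq : (p' : ENNReal).toReal = q := rfl
      rw [hpq] at hgs
      simpa using hgs
    have h6 : lpDen N u = ((∫ x, ‖u x‖ ^ q) ^ q⁻¹) ^ 2 := by
      unfold lpDen
      rw [← Real.rpow_natCast, ← Real.rpow_mul hpos.le]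
      congr 1
      have h2 : (N:ℝ) ≠ 0 := by linarith
      have h3 : (N:ℝ) - 2 ≠ 0 := by linarith
      rw [hq]; push_cast; field_simp
    have h7 : ∫ x, ‖fderiv ℝ u x‖ ^ 2 ≤ ∫ x, grad2 N u x := by
      refine integral_mono_of_nonneg (Filter.Eventually.of_forall fun x => by positivity) ?_
        (Filter.Eventually.of_forall fun x => fderiv_sq_le_grad2 N u x)
      unfold grad2
      refine integrable_finsetSum _ fun j _ => ?_
      refine Continuous.integrable_of_hasCompactSupport ?_ ?_
      · fun_prop
      · exact hds.comp_left (g := fun L : EuclideanSpace ℝ (Fin N) →L[ℝ] ℂ => ‖L (EuclideanSpace.single j 1)‖ ^ 2) (by simp)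
    constructor
    · rw [h6]; positivity
    · rw [h6]
      calc ((∫ x, ‖u x‖ ^ q) ^ q⁻¹) ^ 2 ≤ (C * (∫ x, ‖fderiv ℝ u x‖ ^ 2) ^ (2:ℝ)⁻¹) ^ 2 := by gcongr
        _ = C ^ 2 * ∫ x, ‖fderiv ℝ u x‖ ^ 2 := by
          rw [mul_pow, ← Real.rpow_natCast (_ ^ (2:ℝ)⁻¹), ← Real.rpow_mul hI2]; norm_num
        _ ≤ _ := by gcongr
  have hlow : (1 / ((C:ℝ)^2 + 1)) ≤ SobolevS N := by
    refine le_csInf ?_ ?_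
    · let f : ContDiffBump (0 : EuclideanSpace ℝ (Fin N)) := ⟨1, 2, by norm_num, by norm_num⟩
      refine ⟨_, fun x => ((f x : ℝ) : ℂ), ?_, ?_, ?_, rfl⟩
      · exact Complex.ofRealCLM.contDiff.comp f.contDiff
      · exact f.hasCompactSupport.comp_left (g := fun r : ℝ => (r : ℂ)) (by simp)
      · intro h
        have := congrFun h 0
        have h1 : f 0 = 1 := f.one_of_mem_closedBall (by simp [f])
        simp [h1] at this
    · rintro r ⟨u, hu, hs, hne, rfl⟩
      obtain ⟨h1, h2⟩ := key u hu hs hne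
      have h0 : 0 ≤ ∫ x, grad2 N u x := integral_nonneg fun x => by unfold grad2; positivity
      rw [div_le_div_iff₀ (by positivity) h1]
      nlinarith
  exact lt_of_lt_of_le (by positivity) hlow

lemma geomSum_root (k : ℕ) (z : ℂ) (hz : z ^ k = 1) :
    ∑ j ∈ Finset.Icc 1 k, z ^ j = if z = 1 then (k : ℂ) else 0 := by
  split_ifs with h
  · simp [h]
  · have h1 : ∑ j ∈ Finset.Icc 1 k, z ^ j = z * ∑ j ∈ Finset.range k, z ^ j := by
      rw [Finset.mul_sum, ← Finset.Ico_add_one_right_eq_Icc, Finset.sum_Ico_eq_sum_range]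
      refine Finset.sum_congr (by simp) fun j _ => by rw [pow_add, pow_one]
    rw [h1, geom_sum_eq h, hz]; simp

noncomputable def rootZ (k : ℕ) (t : ℤ) : ℂ := Complex.exp (2 * Real.pi * Complex.I * t / k)

lemma rootZ_pow (k : ℕ) (hk : 1 ≤ k) (t : ℤ) : rootZ k t ^ k = 1 := by
  have hk' : (k : ℂ) ≠ 0 := by exact_mod_cast (by omega : k ≠ 0)
  unfold rootZ
  rw [← Complex.exp_nat_mul, ← Complex.exp_int_mul_two_pi_mul_I t]
  congr 1
  field_simp

lemma phase_cos_term (k : ℕ) (m : ℤ) (n j : ℕ) :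
    Complex.exp (2 * Real.pi * Complex.I * j * m / k) *
      (((Real.cos (2 * Real.pi * j / k)) ^ n : ℝ) : ℂ) =
    (1 / 2 ^ n) * ∑ l ∈ Finset.range (n + 1), (n.choose l : ℂ) * rootZ k (m + 2 * l - n) ^ j := by
  rw [Complex.ofReal_pow, Complex.ofReal_cos, Complex.cos, div_pow, add_pow, mul_div_assoc',
    Finset.mul_sum, Finset.mul_sum, Finset.sum_div]
  refine Finset.sum_congr rfl fun l hl => ?_
  have hl' : l ≤ n := by simp at hl; omega
  have : Complex.exp (2 * Real.pi * Complex.I * j * m / k) *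
      (Complex.exp (((2 * Real.pi * j / k : ℝ) : ℂ) * Complex.I) ^ l *
        Complex.exp (-((2 * Real.pi * j / k : ℝ) : ℂ) * Complex.I) ^ (n - l)) =
      rootZ k (m + 2 * l - n) ^ j := by
    unfold rootZ
    rw [← Complex.exp_nat_mul, ← Complex.exp_nat_mul, ← Complex.exp_nat_mul, ← Complex.exp_add,
      ← Complex.exp_add]
    congr 1
    push_cast [Nat.cast_sub hl']
    ring
  rw [← this]; ring

lemma phase_cos_sum (k : ℕ) (hk : 1 ≤ k) (m : ℤ) (n : ℕ) :
    ∑ j ∈ Finset.Icc 1 k, Complex.exp (2 * Real.pi * Complex.I * j * m / k) *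
      (((Real.cos (2 * Real.pi * j / k)) ^ n : ℝ) : ℂ) =
    (((1 / 2 ^ n) * ∑ l ∈ Finset.range (n + 1), (n.choose l : ℝ) *
      (if rootZ k (m + 2 * l - n) = 1 then (k : ℝ) else 0) : ℝ) : ℂ) := by
  simp_rw [phase_cos_term]
  rw [← Finset.mul_sum, Finset.sum_comm]
  push_cast
  congr 1
  refine Finset.sum_congr rfl fun l _ => ?_
  rw [← Finset.mul_sum, geomSum_root k _ (rootZ_pow k hk _)]
  split_ifs <;> simp

lemma phase_cos_nonneg (k : ℕ) (hk : 1 ≤ k) (m : ℤ) (n : ℕ) :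
    0 ≤ (∑ j ∈ Finset.Icc 1 k, Complex.exp (2 * Real.pi * Complex.I * j * m / k) *
      (((Real.cos (2 * Real.pi * j / k)) ^ n : ℝ) : ℂ)).re := by
  rw [phase_cos_sum k hk, Complex.ofReal_re]
  refine mul_nonneg (by positivity) (Finset.sum_nonneg fun l _ => ?_)
  split_ifs <;> positivity

lemma phase_cos_lower (k : ℕ) (hk : 1 ≤ k) (m : ℤ) :
    (1 / 2 ^ m.natAbs) * (k : ℝ) ≤
     (∑ j ∈ Finset.Icc 1 k, Complex.exp (2 * Real.pi * Complex.I * j * m / k) *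
      (((Real.cos (2 * Real.pi * j / k)) ^ m.natAbs : ℝ) : ℂ)).re := by
  rw [phase_cos_sum k hk, Complex.ofReal_re]
  refine mul_le_mul_of_nonneg_left ?_ (by positivity)
  have hnn : ∀ l ∈ Finset.range (m.natAbs + 1), 0 ≤ (m.natAbs.choose l : ℝ) *
      (if rootZ k (m + 2 * l - m.natAbs) = 1 then (k : ℝ) else 0) := by
    intro l _
    split_ifs <;> positivity
  rcases le_total 0 m with h | h
  · refine le_trans ?_ (Finset.single_le_sum hnn (a := 0) (by simp))
    rw [if_pos]
    · simp
    · have : m + 2 * ((0:ℕ):ℤ) - m.natAbs = 0 := by omega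
      rw [this]; simp [rootZ]
  · refine le_trans ?_ (Finset.single_le_sum hnn (a := m.natAbs) (by simp))
    rw [if_pos]
    · simp
    · have : m + 2 * (m.natAbs:ℤ) - m.natAbs = 0 := by omega
      rw [this]; simp [rootZ]

lemma binom_series (α : ℝ) (hα : 0 < α) : ∃ b : ℕ → ℝ, (∀ n, 0 < b n) ∧
    ∀ y : ℝ, |y| < 1 → HasSum (fun n => b n * y ^ n) ((1 - y) ^ (-α)) := by
  refine ⟨fun n => Ring.multichoose α n, fun n => ?_, fun y hy => ?_⟩
  · have h := Ring.factorial_nsmul_multichoose_eq_ascPochhammer α n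
    rw [Polynomial.ascPochhammer_smeval_eq_eval] at h
    have h2 : 0 < (ascPochhammer ℝ n).eval α := ascPochhammer_pos n α hα
    rw [← h, nsmul_eq_mul] at h2
    exact pos_of_mul_pos_right h2 (by positivity)
  · have h := (Real.one_add_rpow_hasFPowerSeriesOnBall_zero (a := -α)).hasSum (y := -y) (by
      rw [← ENNReal.ofReal_one, Metric.eball_ofReal]; simpa using hy)
    simp only [zero_add] at h
    have he : (fun n => (Ring.multichoose α n : ℝ) * y ^ n) =
        fun n => (binomialSeries ℝ (-α) n) fun _ => -y := by
      funext n
      rw [binomialSeries_apply, Ring.choose_neg']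
      rw [List.ofFn_const, List.prod_replicate, neg_pow, Units.smul_def, Int.coe_negOnePow_natCast]
      have hs : ((-1:ℝ)^n) * (-1)^n = 1 := by rw [← mul_pow]; norm_num
      simp only [zsmul_eq_mul, smul_eq_mul]
      push_cast
      calc Ring.multichoose α n * y ^ n = ((-1:ℝ)^n * (-1)^n) * (Ring.multichoose α n * y ^ n) := by rw [hs, one_mul]
        _ = _ := by ring
    rw [sub_eq_add_neg, he]
    exact h

lemma norm_center (N k j : ℕ) (hN : 4 ≤ N) : ‖center N k 1 j‖ = 1 := by
  obtain ⟨n, rfl⟩ : ∃ n, N = n + 2 := ⟨N - 2, by omega⟩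
  have h : ‖center (n+2) k 1 j‖ ^ 2 = 1 := by
    rw [EuclideanSpace.norm_sq_eq, Fin.sum_univ_succ, Fin.sum_univ_succ]
    simp [center]
  exact (pow_eq_one_iff_of_nonneg (norm_nonneg _) (by norm_num)).1 h

lemma dist_center (N k j : ℕ) (hN : 4 ≤ N) :
    ‖EuclideanSpace.single (⟨0, by omega⟩ : Fin N) (1:ℝ) - center N k 1 j‖ ^ 2 =
      2 - 2 * Real.cos (2 * Real.pi * j / k) := by
  rw [norm_sub_sq_real, norm_center N k j hN, EuclideanSpace.inner_single_left]
  simp [center]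
  ring

lemma bubble_bound (N : ℕ) (hN : 4 ≤ N) : ∃ B : ℝ, 0 < B ∧
    ∀ p : EuclideanSpace ℝ (Fin N), ‖p‖ = 1 → ∀ x, 0 ≤ bubble N p x ∧
      bubble N p x ≤ B * (1 + ‖x‖) ^ (-((N:ℝ) - 2)) ∧
      ∃ L : EuclideanSpace ℝ (Fin N) →L[ℝ] ℝ, HasFDerivAt (bubble N p) L x ∧
        ‖L‖ ≤ B * (1 + ‖x‖) ^ (-((N:ℝ) - 1)) := by
  have hN' : (4:ℝ) ≤ N := by exact_mod_cast hN
  set c0 : ℝ := ((N : ℝ) * ((N : ℝ) - 2)) ^ (((N : ℝ) - 2) / 4) with hc0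
  have hc0pos : 0 < c0 := by
    apply Real.rpow_pos_of_pos; apply mul_pos <;> linarith
  have dec : ∀ p : EuclideanSpace ℝ (Fin N), ‖p‖ = 1 → ∀ x, ∀ s : ℝ, 0 ≤ s →
      (1 + ‖x - p‖ ^ 2) ^ (-(s/2)) ≤ (8:ℝ) ^ (s/2) * (1 + ‖x‖) ^ (-s) := by
    intro p hp x s hs
    have h1 : ‖x‖ ≤ ‖x - p‖ + 1 := by
      calc ‖x‖ = ‖(x - p) + p‖ := by simp
        _ ≤ _ := by rw [← hp]; exact norm_add_le _ _
    have h2 : (1 + ‖x‖) ^ 2 / 8 ≤ 1 + ‖x - p‖ ^ 2 := by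
      have := norm_nonneg x
      have := norm_nonneg (x - p)
      nlinarith [sq_nonneg (‖x - p‖ - 1)]
    calc (1 + ‖x - p‖ ^ 2) ^ (-(s/2)) ≤ ((1 + ‖x‖) ^ 2 / 8) ^ (-(s/2)) :=
          Real.rpow_le_rpow_of_nonpos (by positivity) h2 (by linarith)
      _ = (8:ℝ) ^ (s/2) * (1 + ‖x‖) ^ (-s) := by
          rw [Real.div_rpow (by positivity) (by norm_num), ← Real.rpow_natCast (1 + ‖x‖),
            ← Real.rpow_mul (by positivity), Real.rpow_neg (by norm_num : (0:ℝ) ≤ 8), div_inv_eq_mul, mul_comm]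
          congr 2; push_cast; ring
  refine ⟨c0 * ((N:ℝ) - 2) * 8 ^ (((N:ℝ) - 1)/2), ?_, fun p hp x => ⟨?_, ?_, ?_⟩⟩
  · have : 0 < (N:ℝ) - 2 := by linarith
    positivity
  · unfold bubble; rw [← hc0]; positivity
  · unfold bubble; rw [← hc0]
    have h1 := dec p hp x ((N:ℝ) - 2) (by linarith)
    have h2 : (8:ℝ) ^ (((N:ℝ) - 2)/2) ≤ ((N:ℝ) - 2) * 8 ^ (((N:ℝ) - 1)/2) := by
      have : (8:ℝ) ^ (((N:ℝ) - 2)/2) ≤ 8 ^ (((N:ℝ) - 1)/2) :=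
        Real.rpow_le_rpow_of_exponent_le (by norm_num) (by linarith)
      have h3 : (0:ℝ) < 8 ^ (((N:ℝ) - 1)/2) := by positivity
      nlinarith
    calc c0 * (1 + ‖x - p‖ ^ 2) ^ (-(((N:ℝ) - 2) / 2))
        ≤ c0 * (8 ^ (((N:ℝ) - 2)/2) * (1 + ‖x‖) ^ (-((N:ℝ) - 2))) := by gcongr
      _ ≤ c0 * ((((N:ℝ) - 2) * 8 ^ (((N:ℝ) - 1)/2)) * (1 + ‖x‖) ^ (-((N:ℝ) - 2))) := by gcongr
      _ = _ := by ring
  · have hf : HasFDerivAt (fun y : EuclideanSpace ℝ (Fin N) => 1 + ‖y - p‖ ^ 2)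
        (2 • (innerSL ℝ (x - p))) x := by
      have := ((hasFDerivAt_id x).sub_const p).norm_sq.const_add 1
      simpa using this
    have hpos : 0 < 1 + ‖x - p‖ ^ 2 := by positivity
    have hg := (hf.rpow_const (p := -(((N:ℝ) - 2)/2)) (Or.inl hpos.ne')).const_mul c0
    refine ⟨_, hg, ?_⟩
    have h1 := dec p hp x ((N:ℝ) - 1) (by linarith)
    have h2 : ‖innerSL ℝ (x - p)‖ ≤ (1 + ‖x - p‖ ^ 2) ^ ((1:ℝ)/2) := by
      rw [innerSL_apply_norm, ← Real.sqrt_eq_rpow]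
      apply Real.le_sqrt_of_sq_le; linarith
    have hN2 : 0 < (N:ℝ) - 2 := by linarith
    have h3 : ‖(2 • (innerSL ℝ (x - p)) : EuclideanSpace ℝ (Fin N) →L[ℝ] ℝ)‖
        ≤ 2 * (1 + ‖x - p‖ ^ 2) ^ ((1:ℝ)/2) := by
      refine norm_nsmul_le.trans ?_
      push_cast
      gcongr
    rw [norm_smul, norm_smul, norm_mul, norm_neg, Real.norm_of_nonneg hc0pos.le,
      Real.norm_of_nonneg (by positivity : 0 ≤ ((N:ℝ) - 2) / 2), Real.norm_of_nonneg (by positivity)]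
    have h4 : (1 + ‖x - p‖ ^ 2) ^ (-(((N:ℝ) - 2) / 2) - 1) * (1 + ‖x - p‖ ^ 2) ^ ((1:ℝ)/2) =
        (1 + ‖x - p‖ ^ 2) ^ (-(((N:ℝ) - 1)/2)) := by
      rw [← Real.rpow_add hpos]; congr 1; ring
    calc _ ≤ c0 * (((N:ℝ) - 2) / 2 * (1 + ‖x - p‖ ^ 2) ^ (-(((N:ℝ) - 2) / 2) - 1) *
          (2 * (1 + ‖x - p‖ ^ 2) ^ ((1:ℝ)/2))) := by gcongr
      _ = c0 * ((N:ℝ) - 2) * (1 + ‖x - p‖ ^ 2) ^ (-(((N:ℝ) - 1)/2)) := by rw [← h4]; ring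
      _ ≤ c0 * ((N:ℝ) - 2) * ((8:ℝ) ^ (((N:ℝ) - 1)/2) * (1 + ‖x‖) ^ (-((N:ℝ) - 1))) := by gcongr
      _ = _ := by ring

lemma wfun_phase (k j : ℕ) (m : ℤ) :
    ‖Complex.exp (2 * Real.pi * Complex.I * j * m / k)‖ = 1 := by
  have : (2 * Real.pi * Complex.I * j * m / k : ℂ) = ((2 * Real.pi * j * m / k : ℝ) : ℂ) * Complex.I := by
    push_cast; ring
  rw [this, Complex.norm_exp_ofReal_mul_I]

noncomputable def usum (N k : ℕ) (m : ℤ) (x : EuclideanSpace ℝ (Fin N)) : ℂ :=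
  ∑ j ∈ Finset.Icc 1 k, wfun N k m 1 j x

lemma usum_bound (N : ℕ) (hN : 4 ≤ N) (m : ℤ) : ∃ B : ℝ, 0 < B ∧ ∀ k : ℕ,
    Differentiable ℝ (usum N k m) ∧
    (∀ x, ‖usum N k m x‖ ≤ k * B * (1 + ‖x‖) ^ (-((N:ℝ) - 2))) ∧
    (∀ x, ‖fderiv ℝ (usum N k m) x‖ ≤ k * B * (1 + ‖x‖) ^ (-((N:ℝ) - 1))) := by
  obtain ⟨B, hB, h⟩ := bubble_bound N hN
  refine ⟨B, hB, fun k => ?_⟩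
  have hd : ∀ x, ∃ L : EuclideanSpace ℝ (Fin N) →L[ℝ] ℂ, HasFDerivAt (usum N k m) L x ∧
      ‖L‖ ≤ k * B * (1 + ‖x‖) ^ (-((N:ℝ) - 1)) := by
    intro x
    have hj : ∀ j, ∃ L : EuclideanSpace ℝ (Fin N) →L[ℝ] ℂ, HasFDerivAt (wfun N k m 1 j) L x ∧
        ‖L‖ ≤ B * (1 + ‖x‖) ^ (-((N:ℝ) - 1)) := by
      intro j
      obtain ⟨-, -, L, hL, hLn⟩ := h (center N k 1 j) (norm_center N k j hN) x
      refine ⟨_, (Complex.ofRealCLM.hasFDerivAt.comp x hL).const_mul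
        (Complex.exp (2 * Real.pi * Complex.I * j * m / k)), ?_⟩
      rw [norm_smul, wfun_phase, one_mul]
      refine (ContinuousLinearMap.opNorm_comp_le _ _).trans ?_
      rw [Complex.ofRealCLM_norm, one_mul]
      exact hLn
    choose L hL hLn using hj
    refine ⟨∑ j ∈ Finset.Icc 1 k, L j, ?_, ?_⟩
    · exact HasFDerivAt.fun_sum fun j _ => hL j
    · refine (norm_sum_le _ _).trans ?_
      refine (Finset.sum_le_sum fun j _ => hLn j).trans ?_
      simp [mul_assoc]
  refine ⟨fun x => ?_, fun x => ?_, fun x => ?_⟩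
  · obtain ⟨L, hL, -⟩ := hd x
    exact hL.differentiableAt
  · refine (norm_sum_le _ _).trans ?_
    have : ∀ j ∈ Finset.Icc 1 k, ‖wfun N k m 1 j x‖ ≤ B * (1 + ‖x‖) ^ (-((N:ℝ) - 2)) := by
      intro j _
      obtain ⟨h0, h1, -⟩ := h (center N k 1 j) (norm_center N k j hN) x
      rw [wfun, norm_mul, wfun_phase, one_mul, Complex.norm_real, Real.norm_of_nonneg h0]
      exact h1
    refine (Finset.sum_le_sum this).trans ?_
    simp [mul_assoc]
  · obtain ⟨L, hL, hn⟩ := hd x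
    rw [hL.fderiv]; exact hn

lemma integrable_h2 (N : ℕ) (hN : 4 ≤ N) :
    Integrable (fun x : EuclideanSpace ℝ (Fin N) => (1 + ‖x‖) ^ (-(2 * (N:ℝ) - 4)) / ‖x‖ ^ 2) := by
  have hN' : (4:ℝ) ≤ N := by exact_mod_cast hN
  have : Nontrivial (EuclideanSpace ℝ (Fin N)) := by
    apply Module.nontrivial_of_finrank_pos (R := ℝ); simp; omega
  rw [integrable_fun_norm_addHaar (μ := (volume : Measure (EuclideanSpace ℝ (Fin N))))
    (f := fun y : ℝ => (1 + y) ^ (-(2 * (N:ℝ) - 4)) / y ^ 2)]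
  have h1 : Integrable (fun y : ℝ => (1 + ‖y‖) ^ (-(2:ℝ))) := integrable_one_add_norm (by simp)
  refine Integrable.mono' h1.integrableOn (Measurable.aestronglyMeasurable (by fun_prop)) ?_
  refine (ae_restrict_iff' measurableSet_Ioi).2 (Filter.Eventually.of_forall fun y hy => ?_)
  have hy : 0 < y := hy
  rw [Real.norm_of_nonneg (by simp only [smul_eq_mul]; positivity), Real.norm_of_nonneg hy.le]
  simp only [finrank_euclideanSpace, Fintype.card_fin, smul_eq_mul]
  have e1 : y ^ (N - 1) * ((1 + y) ^ (-(2 * (N:ℝ) - 4)) / y ^ 2) =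
      y ^ (N - 3) * (1 + y) ^ (-(2 * (N:ℝ) - 4)) := by
    rw [show N - 1 = (N - 3) + 2 by omega, pow_add]; field_simp
  rw [e1]
  calc y ^ (N - 3) * (1 + y) ^ (-(2 * (N:ℝ) - 4)) ≤ (1 + y) ^ (N - 3) * (1 + y) ^ (-(2 * (N:ℝ) - 4)) := by
        gcongr; linarith
    _ = (1 + y) ^ (-((N:ℝ) - 1)) := by
        rw [← Real.rpow_natCast, ← Real.rpow_add (by positivity)]
        congr 1
        rw [Nat.cast_sub (by omega)]; push_cast; ring
    _ ≤ _ := Real.rpow_le_rpow_of_exponent_le (by linarith) (by linarith)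

lemma Q_bound (N : ℕ) (hN : 4 ≤ N) (m : ℤ)
    (A : EuclideanSpace ℝ (Fin N) → EuclideanSpace ℝ (Fin N))
    (CA : ℝ) (hAbd : ∀ θ : EuclideanSpace ℝ (Fin N), ‖A θ‖ ≤ CA) (a : ℝ) :
    ∃ C : ℝ, ∀ k : ℕ, Qconst N A a (usum N k m) ≤ C * (k:ℝ) ^ 2 := by
  have hN' : (4:ℝ) ≤ N := by exact_mod_cast hN
  obtain ⟨B, hB, h⟩ := usum_bound N hN m
  have i2 := integrable_h2 N hN
  have i1 : Integrable (fun x : EuclideanSpace ℝ (Fin N) => (1 + ‖x‖) ^ (-(2 * (N:ℝ) - 2))) :=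
    integrable_one_add_norm (by simp; linarith)
  set h1 := fun x : EuclideanSpace ℝ (Fin N) => (1 + ‖x‖) ^ (-(2 * (N:ℝ) - 2)) with hh1
  set h2 := fun x : EuclideanSpace ℝ (Fin N) => (1 + ‖x‖) ^ (-(2 * (N:ℝ) - 4)) / ‖x‖ ^ 2 with hh2
  have hCA : 0 ≤ CA := (norm_nonneg _).trans (hAbd 0)
  refine ⟨N * (2 * B ^ 2 * (∫ x, h1 x) + 2 * CA ^ 2 * B ^ 2 * ∫ x, h2 x) + |a| * (B ^ 2 * ∫ x, h2 x), fun k => ?_⟩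
  obtain ⟨-, hu, hdu⟩ := h k
  have sq1 : ∀ x, ‖fderiv ℝ (usum N k m) x‖ ^ 2 ≤ k ^ 2 * B ^ 2 * h1 x := by
    intro x
    calc ‖fderiv ℝ (usum N k m) x‖ ^ 2 ≤ (k * B * (1 + ‖x‖) ^ (-((N:ℝ) - 1))) ^ 2 := by
          gcongr; exact hdu x
      _ = _ := by
          rw [mul_pow, mul_pow, ← Real.rpow_natCast (_ ^ (-((N:ℝ) - 1))), ← Real.rpow_mul (by positivity), hh1]
          congr 2; push_cast; ring
  have sq2 : ∀ x, ‖usum N k m x‖ ^ 2 / ‖x‖ ^ 2 ≤ k ^ 2 * B ^ 2 * h2 x := by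
    intro x
    calc ‖usum N k m x‖ ^ 2 / ‖x‖ ^ 2 ≤ (k * B * (1 + ‖x‖) ^ (-((N:ℝ) - 2))) ^ 2 / ‖x‖ ^ 2 := by
          gcongr; exact hu x
      _ = _ := by
          rw [mul_pow, mul_pow, ← Real.rpow_natCast (_ ^ (-((N:ℝ) - 2))), ← Real.rpow_mul (by positivity), hh2, mul_div_assoc]
          congr 3; push_cast; ring
  have I1 : ∫ x, magGrad2 N A (usum N k m) x ≤
      ∫ x, N * k ^ 2 * (2 * B ^ 2 * h1 x + 2 * CA ^ 2 * B ^ 2 * h2 x) := by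
    refine integral_mono_of_nonneg (Filter.Eventually.of_forall fun x => ?_) ?_
      (Filter.Eventually.of_forall fun x => ?_)
    · simp only [magGrad2, Pi.zero_apply]; positivity
    · exact ((i1.const_mul _).add (i2.const_mul _)).const_mul _
    · simp only [magGrad2]
      have hb : ∀ j : Fin N, ‖Complex.I * fderiv ℝ (usum N k m) x (EuclideanSpace.single j 1)
          - ((A (‖x‖⁻¹ • x) j / ‖x‖ : ℝ) : ℂ) * usum N k m x‖ ^ 2 ≤
          k ^ 2 * (2 * B ^ 2 * h1 x + 2 * CA ^ 2 * B ^ 2 * h2 x) := by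
        intro j
        have b1 : ‖Complex.I * fderiv ℝ (usum N k m) x (EuclideanSpace.single j 1)‖ ≤
            ‖fderiv ℝ (usum N k m) x‖ := by
          rw [norm_mul, Complex.norm_I, one_mul]
          refine (ContinuousLinearMap.le_opNorm _ _).trans ?_
          simp
        have b2 : ‖((A (‖x‖⁻¹ • x) j / ‖x‖ : ℝ) : ℂ) * usum N k m x‖ ≤ CA * (‖usum N k m x‖ / ‖x‖) := by
          rw [norm_mul, Complex.norm_real, norm_div, norm_norm]
          have : ‖A (‖x‖⁻¹ • x) j‖ ≤ CA := (PiLp.norm_apply_le _ j).trans (hAbd _)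
          calc _ = ‖A (‖x‖⁻¹ • x) j‖ * (‖usum N k m x‖ / ‖x‖) := by ring
            _ ≤ _ := by gcongr
        have b3 := (norm_sub_le _ _).trans (add_le_add b1 b2)
        calc _ ≤ (‖fderiv ℝ (usum N k m) x‖ + CA * (‖usum N k m x‖ / ‖x‖)) ^ 2 := by gcongr
          _ ≤ 2 * ‖fderiv ℝ (usum N k m) x‖ ^ 2 + 2 * CA ^ 2 * (‖usum N k m x‖ ^ 2 / ‖x‖ ^ 2) := by
            rw [← div_pow]
            nlinarith [sq_nonneg (‖fderiv ℝ (usum N k m) x‖ - CA * (‖usum N k m x‖ / ‖x‖))]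
          _ ≤ 2 * (k ^ 2 * B ^ 2 * h1 x) + 2 * CA ^ 2 * (k ^ 2 * B ^ 2 * h2 x) := by
            gcongr
            · exact sq1 x
            · exact sq2 x
          _ = _ := by ring
      refine (Finset.sum_le_sum fun j _ => hb j).trans ?_
      simp [mul_assoc]
  have I2 : ∫ x, ‖usum N k m x‖ ^ 2 / ‖x‖ ^ 2 ≤ ∫ x, k ^ 2 * B ^ 2 * h2 x := by
    refine integral_mono_of_nonneg (Filter.Eventually.of_forall fun x => ?_) (i2.const_mul _)
      (Filter.Eventually.of_forall sq2)
    simp only [Pi.zero_apply]; positivity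
  have I0 : 0 ≤ ∫ x, ‖usum N k m x‖ ^ 2 / ‖x‖ ^ 2 := integral_nonneg fun x => by positivity
  rw [integral_const_mul, integral_add (i1.const_mul _) (i2.const_mul _), integral_const_mul,
    integral_const_mul] at I1
  rw [integral_const_mul] at I2
  unfold Qconst
  have h3 : -a * (∫ x, ‖usum N k m x‖ ^ 2 / ‖x‖ ^ 2) ≤ |a| * (k ^ 2 * B ^ 2 * ∫ x, h2 x) := by
    calc _ ≤ |a| * (∫ x, ‖usum N k m x‖ ^ 2 / ‖x‖ ^ 2) := by
          gcongr; exact neg_le_abs a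
      _ ≤ _ := by gcongr
  linarith

lemma usum_lower (N : ℕ) (hN : 4 ≤ N) (m : ℤ) : ∃ c : ℝ, 0 < c ∧ ∀ k : ℕ, 1 ≤ k →
    c * k ≤ ‖usum N k m (EuclideanSpace.single (⟨0, by omega⟩ : Fin N) (1:ℝ))‖ := by
  have hN' : (4:ℝ) ≤ N := by exact_mod_cast hN
  obtain ⟨b, hb, hs⟩ := binom_series (((N:ℝ) - 2)/2) (by linarith)
  set c0 : ℝ := ((N : ℝ) * ((N : ℝ) - 2)) ^ (((N : ℝ) - 2) / 4) with hc0
  have hc0pos : 0 < c0 := by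
    apply Real.rpow_pos_of_pos; apply mul_pos <;> linarith
  set c1 : ℝ := c0 * 3 ^ (-(((N:ℝ) - 2)/2)) with hc1
  have hc1pos : 0 < c1 := by positivity
  set M := m.natAbs with hM
  refine ⟨c1 * (b M * (2/3) ^ M * (1 / 2 ^ M)), by have := hb M; positivity, fun k hk => ?_⟩
  set e : ℕ → ℂ := fun j => Complex.exp (2 * Real.pi * Complex.I * j * m / k) with he
  set t : ℕ → ℝ := fun j => Real.cos (2 * Real.pi * j / k) with ht
  set x0 := EuclideanSpace.single (⟨0, by omega⟩ : Fin N) (1:ℝ) with hx0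
  have hbub : ∀ j, bubble N (center N k 1 j) x0 = c1 * (1 - 2/3 * t j) ^ (-(((N:ℝ) - 2)/2)) := by
    intro j
    have h1 : 0 ≤ 1 - 2/3 * t j := by
      have := Real.cos_le_one (2 * Real.pi * j / k)
      simp only [ht]; linarith
    rw [bubble, dist_center N k j hN, ← hc0, hc1, mul_assoc c0, ← Real.mul_rpow (by norm_num) h1]
    congr 2; simp only [ht]; ring
  have hsum : HasSum (fun n => b n * (2/3)^n * (∑ j ∈ Finset.Icc 1 k, e j * ((t j ^ n : ℝ) : ℂ)).re)
      ((∑ j ∈ Finset.Icc 1 k, e j * (((1 - 2/3 * t j) ^ (-(((N:ℝ) - 2)/2)) : ℝ) : ℂ)).re) := by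
    have h1 : ∀ j ∈ Finset.Icc 1 k, HasSum (fun n => (e j * ((b n * (2/3 * t j) ^ n : ℝ) : ℂ)).re)
        ((e j * (((1 - 2/3 * t j) ^ (-(((N:ℝ) - 2)/2)) : ℝ) : ℂ)).re) := by
      intro j _
      have hlt : |2/3 * t j| < 1 := by
        rw [abs_mul]
        have := Real.abs_cos_le_one (2 * Real.pi * j / k)
        rw [abs_of_pos (by norm_num : (0:ℝ) < 2/3)]
        simp only [ht]; linarith
      simpa only [Complex.re_mul_ofReal] using (hs _ hlt).mul_left (e j).re
    have h2 := hasSum_sum h1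
    rw [Complex.re_sum]
    convert h2 using 2 with n
    rw [Complex.re_sum, Finset.mul_sum]
    refine Finset.sum_congr rfl fun j _ => ?_
    rw [Complex.re_mul_ofReal, Complex.re_mul_ofReal, mul_pow]; ring
  have hle := le_hasSum hsum M (fun n _ => mul_nonneg (by have := hb n; positivity)
    (phase_cos_nonneg k hk m n))
  have hlow := phase_cos_lower k hk m
  have heq : usum N k m x0 = (c1 : ℂ) * ∑ j ∈ Finset.Icc 1 k, e j * (((1 - 2/3 * t j) ^ (-(((N:ℝ) - 2)/2)) : ℝ) : ℂ) := by
    rw [usum, Finset.mul_sum]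
    refine Finset.sum_congr rfl fun j _ => ?_
    rw [wfun, hbub]; push_cast; ring
  refine le_trans ?_ (Complex.re_le_norm _)
  rw [heq, Complex.re_ofReal_mul, mul_assoc]
  refine mul_le_mul_of_nonneg_left (le_trans ?_ hle) hc1pos.le
  rw [mul_assoc (b M * (2/3) ^ M)]
  refine mul_le_mul_of_nonneg_left hlow (by have := hb M; positivity)

lemma lpDen_lower (N : ℕ) (hN : 4 ≤ N) (m : ℤ) : ∃ c : ℝ, 0 < c ∧ ∀ k : ℕ, 1 ≤ k →
    c * (k:ℝ) ^ 2 ≤ lpDen N (usum N k m) := by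
  have hN' : (4:ℝ) ≤ N := by exact_mod_cast hN
  obtain ⟨c, hc, hlow⟩ := usum_lower N hN m
  obtain ⟨B, hB, h⟩ := usum_bound N hN m
  set x0 := EuclideanSpace.single (⟨0, by omega⟩ : Fin N) (1:ℝ) with hx0
  set q : ℝ := (2 * (N : ℝ)) / ((N : ℝ) - 2) with hq
  have hqpos : 0 < q := by apply div_pos <;> linarith
  set δ := c / (2 * B) with hδ
  have hδpos : 0 < δ := by positivity
  set V := (volume (Metric.ball x0 δ)).toReal with hV
  have hVpos : 0 < V := ENNReal.toReal_pos (Metric.measure_ball_pos _ _ hδpos).ne' measure_ball_lt_top.ne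
  refine ⟨(c/2)^2 * V ^ (((N : ℝ) - 2) / (N : ℝ)), by positivity, fun k hk => ?_⟩
  obtain ⟨hdiff, hu, hdu⟩ := h k
  have hqint : Integrable (fun x => ‖usum N k m x‖ ^ q) := by
    have i1 : Integrable (fun x : EuclideanSpace ℝ (Fin N) => (1 + ‖x‖) ^ (-(2 * (N:ℝ)))) :=
      integrable_one_add_norm (by simp; linarith)
    refine Integrable.mono' (i1.const_mul ((k * B) ^ q)) ?_ (Filter.Eventually.of_forall fun x => ?_)
    · exact (hdiff.continuous.norm.rpow_const (fun x => Or.inr hqpos.le)).aestronglyMeasurable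
    · rw [Real.norm_of_nonneg (by positivity)]
      calc ‖usum N k m x‖ ^ q ≤ (k * B * (1 + ‖x‖) ^ (-((N:ℝ) - 2))) ^ q :=
            Real.rpow_le_rpow (norm_nonneg _) (hu x) hqpos.le
        _ = _ := by
            rw [Real.mul_rpow (by positivity) (by positivity), ← Real.rpow_mul (by positivity)]
            congr 2
            have h3 : (N:ℝ) - 2 ≠ 0 := by linarith
            rw [hq]; field_simp
  have hball : ∀ x ∈ Metric.ball x0 δ, c / 2 * k ≤ ‖usum N k m x‖ := by
    intro x hx
    have hlip : ‖usum N k m x - usum N k m x0‖ ≤ (k * B) * ‖x - x0‖ := by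
      refine Convex.norm_image_sub_le_of_norm_fderiv_le (𝕜 := ℝ) (s := Set.univ) (fun y _ => hdiff y)
        (fun y _ => (hdu y).trans ?_) convex_univ (Set.mem_univ _) (Set.mem_univ _)
      refine mul_le_of_le_one_right (by positivity) ?_
      apply Real.rpow_le_one_of_one_le_of_nonpos
      · linarith [norm_nonneg y]
      · linarith
    have hx' : ‖x - x0‖ ≤ δ := by rw [← dist_eq_norm]; exact (Metric.mem_ball.1 hx).le
    have h1 : (k * B) * ‖x - x0‖ ≤ c / 2 * k := by
      calc (k * B) * ‖x - x0‖ ≤ (k * B) * δ := by gcongr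
        _ = _ := by rw [hδ]; field_simp
    have h2 := hlow k hk
    have h3 := norm_sub_norm_le (usum N k m x0) (usum N k m x)
    rw [norm_sub_rev] at h3
    linarith
  have hI : (c / 2 * k) ^ q * V ≤ ∫ x, ‖usum N k m x‖ ^ q := by
    calc (c / 2 * k) ^ q * V = ∫ x in Metric.ball x0 δ, (c / 2 * k) ^ q := by
          rw [setIntegral_const, smul_eq_mul, mul_comm]; rfl
      _ ≤ ∫ x in Metric.ball x0 δ, ‖usum N k m x‖ ^ q := by
          refine setIntegral_mono_on (by simp [measure_ball_lt_top]) hqint.integrableOn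
            measurableSet_ball fun x hx => ?_
          exact Real.rpow_le_rpow (by positivity) (hball x hx) hqpos.le
      _ ≤ _ := setIntegral_le_integral hqint (Filter.Eventually.of_forall fun x => by
          simp only [Pi.zero_apply]; positivity)
  unfold lpDen
  refine le_trans (le_of_eq ?_) (Real.rpow_le_rpow (by positivity) hI (div_nonneg (by linarith) (by linarith)))
  rw [Real.mul_rpow (by positivity) hVpos.le, ← Real.rpow_mul (by positivity)]
  have : q * (((N:ℝ) - 2) / N) = (2:ℕ) := by
    have h3 : (N:ℝ) - 2 ≠ 0 := by linarith
    have h2 : (N:ℝ) ≠ 0 := by linarith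
    rw [hq]; push_cast; field_simp
  rw [this, Real.rpow_natCast]; ring

/-- for a suitable choice of `k` and `R`, the magnetic Rayleigh quotient
of `Σ_{j=1}^k w_j` is strictly below `k^{2/N} S`. -/
theorem stmt_14 (N : ℕ) (hN : 4 ≤ N) (m : ℤ)
    (A : EuclideanSpace ℝ (Fin N) → EuclideanSpace ℝ (Fin N))
    (hAmeas : Measurable A) (CA : ℝ) (hAbd : ∀ θ : EuclideanSpace ℝ (Fin N), ‖A θ‖ ≤ CA)
    (a : ℝ) (ha : |a| < ((N : ℝ) - 2) ^ 2 / 4) :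
    ∃ k : ℕ, 2 ≤ k ∧ ∃ R : ℝ, 0 < R ∧
      Qconst N A a (fun x => ∑ j ∈ Finset.Icc 1 k, wfun N k m R j x) <
        (k : ℝ) ^ ((2 : ℝ) / (N : ℝ)) * SobolevS N *
          lpDen N (fun x => ∑ j ∈ Finset.Icc 1 k, wfun N k m R j x) := by
  have hN' : (4:ℝ) ≤ N := by exact_mod_cast hN
  obtain ⟨C, hC⟩ := Q_bound N hN m A CA hAbd a
  obtain ⟨c, hc, hl⟩ := lpDen_lower N hN m
  have hS := sobolev_pos N hN
  have htend : Filter.Tendsto (fun k : ℕ => (k : ℝ) ^ ((2 : ℝ) / (N : ℝ))) Filter.atTop Filter.atTop :=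
    (tendsto_rpow_atTop (by positivity)).comp tendsto_natCast_atTop_atTop
  obtain ⟨k, hk1, hk2⟩ := ((htend.eventually_gt_atTop (C / (SobolevS N * c))).and
    (Filter.eventually_ge_atTop 2)).exists
  refine ⟨k, hk2, 1, one_pos, ?_⟩
  change Qconst N A a (usum N k m) < _ * lpDen N (usum N k m)
  have hkpos : (0:ℝ) < k := by exact_mod_cast (by omega : 0 < k)
  rw [div_lt_iff₀ (by positivity)] at hk1
  calc Qconst N A a (usum N k m) ≤ C * (k:ℝ) ^ 2 := hC k
    _ < ((k : ℝ) ^ ((2 : ℝ) / (N : ℝ)) * (SobolevS N * c)) * (k:ℝ) ^ 2 := by gcongr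
    _ = (k : ℝ) ^ ((2 : ℝ) / (N : ℝ)) * SobolevS N * (c * (k:ℝ) ^ 2) := by ring
    _ ≤ _ := by
      gcongr
      exact hl k (by omega)
end

section
/- Let N ≥ 4 and α ∈ ℝ. For every φ ∈ C_c^∞(ℝ^N ∖ Σ, ℂ): (min_{j∈ℤ} |j − α|)² · ∫_{ℝ^N} |φ(x)|²/(x₁²+x₂²) dx ≤ ∫_{ℝ^N} |(i∇−𝒜)φ(x)|² dx (Hardy-type inequality for the N-dimensional Aharonov–Bohm potential, obtained from the two-dimensional one by separating variables). -/
open MeasureTheory Complex Filter Metric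

/-- the `i`-th coordinate of a point of `ℝ^N` (junk value `0` if `i ≥ N`). -/
noncomputable def coord (N : ℕ) (i : ℕ) (x : EuclideanSpace ℝ (Fin N)) : ℝ :=
  if h : i < N then x ⟨i, h⟩ else 0

/-- the Aharonov–Bohm potential
`𝒜(x) = (−α x₂/(x₁²+x₂²), α x₁/(x₁²+x₂²), 0, …, 0)`. -/
noncomputable def abPot (N : ℕ) (α : ℝ) (x : EuclideanSpace ℝ (Fin N)) :
    EuclideanSpace ℝ (Fin N) :=
  (EuclideanSpace.equiv (Fin N) ℝ).symm fun i =>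
    if (i : ℕ) = 0 then -α * coord N 1 x / (coord N 0 x ^ 2 + coord N 1 x ^ 2)
    else if (i : ℕ) = 1 then α * coord N 0 x / (coord N 0 x ^ 2 + coord N 1 x ^ 2)
    else 0

/-- the singular set `Σ = {x : x₁ = x₂ = 0}` of the Aharonov–Bohm potential. -/
def ABsing (N : ℕ) : Set (EuclideanSpace ℝ (Fin N)) :=
  {x | coord N 0 x = 0 ∧ coord N 1 x = 0}

/-- squared pointwise norm of `(i∇−𝒜)φ(x) = i∇φ(x) − 𝒜(x)φ(x)`. -/
noncomputable def abGrad2 (N : ℕ) (α : ℝ) (φ : EuclideanSpace ℝ (Fin N) → ℂ)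
    (x : EuclideanSpace ℝ (Fin N)) : ℝ :=
  ∑ j : Fin N, ‖Complex.I * fderiv ℝ φ x (EuclideanSpace.single j 1)
      - ((abPot N α x j : ℝ) : ℂ) * φ x‖ ^ 2

/-- `min_{j ∈ ℤ} |j − α|`. -/
noncomputable def minDist (α : ℝ) : ℝ :=
  sInf { t : ℝ | ∃ j : ℤ, t = |(j : ℝ) - α| }

theorem minDist_le (α : ℝ) (j : ℤ) : minDist α ≤ |(j : ℝ) - α| := by
  apply csInf_le
  · exact ⟨0, by rintro t ⟨j, rfl⟩; positivity⟩
  · exact ⟨j, rfl⟩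

theorem minDist_nonneg (α : ℝ) : 0 ≤ minDist α := by
  apply Real.sInf_nonneg
  rintro t ⟨j, rfl⟩; positivity

/-- one-dimensional magnetic Wirtinger inequality on the circle -/
theorem circle_ineq (α : ℝ) (f f' : ℝ → ℂ) (hf : ∀ t, HasDerivAt f (f' t) t)
    (hf' : Continuous f') (hper : f (2 * Real.pi) = f 0) :
    minDist α ^ 2 * ∫ t in (0 : ℝ)..(2 * Real.pi), ‖f t‖ ^ 2 ≤
      ∫ t in (0 : ℝ)..(2 * Real.pi), ‖I * f' t - (α : ℂ) * f t‖ ^ 2 := by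
  have hab : (0 : ℝ) < 2 * Real.pi := by positivity
  have hfc : Continuous f := continuous_iff_continuousAt.2 fun t => (hf t).continuousAt
  have hgc : Continuous (fun t => I * f' t - (α : ℂ) * f t) := by fun_prop
  have hL : ∀ g : ℝ → ℂ, Continuous g →
      MemLp g 2 (volume.restrict (Set.Ioc 0 (2 * Real.pi))) := by
    intro g hg
    have h1 : MemLp g 2 (volume.restrict (Set.Icc 0 (2 * Real.pi))) := by
      obtain ⟨C, hC⟩ := isCompact_Icc.exists_bound_of_continuousOn
        (hg.continuousOn (s := Set.Icc 0 (2 * Real.pi)))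
      refine MemLp.of_bound hg.aestronglyMeasurable C ?_
      exact (ae_restrict_iff' measurableSet_Icc).2 (Eventually.of_forall hC)
    exact h1.mono_measure (Measure.restrict_mono Set.Ioc_subset_Icc_self le_rfl)
  have S1 := hasSum_sq_fourierCoeffOn hab (hL f hfc)
  have S2 := hasSum_sq_fourierCoeffOn hab (hL _ hgc)
  have key : ∀ n : ℤ, fourierCoeffOn hab (fun t => I * f' t - (α : ℂ) * f t) n
      = (-(n : ℂ) - α) * fourierCoeffOn hab f n := by
    intro n
    rw [fourierCoeffOn_eq_integral, fourierCoeffOn_eq_integral]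
    set e : ℝ → ℂ := fun x => fourier (-n) (x : AddCircle (2 * Real.pi - 0)) with he
    have hde : ∀ x, HasDerivAt e (-I * n * e x) x := by
      intro x
      have := hasDerivAt_fourier_neg (2 * Real.pi - 0) n x
      convert this using 1
      have hpi : (Real.pi : ℂ) ≠ 0 := by exact_mod_cast Real.pi_ne_zero
      push_cast
      simp only [he]
      field_simp
      ring
    have hec : Continuous e := continuous_iff_continuousAt.2 fun t => (hde t).continuousAt
    have hint : ∫ x in (0 : ℝ)..(2 * Real.pi), (-I * n * e x * f x + e x * f' x) = 0 := by
      rw [intervalIntegral.integral_eq_sub_of_hasDerivAt (f := fun x => e x * f x)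
        (fun x _ => (hde x).mul (hf x))]
      · have h2 : e (2 * Real.pi) = e 0 := by
          simp only [he]
          congr 1
          simp
        simp only [hper, h2, sub_self]
      · apply Continuous.intervalIntegrable
        fun_prop
    have i1 : IntervalIntegrable (fun x => I * (-I * n * e x * f x + e x * f' x)) volume 0
        (2 * Real.pi) := by
      apply Continuous.intervalIntegrable; fun_prop
    have i2 : IntervalIntegrable (fun x => (-(n : ℂ) - α) * (e x * f x)) volume 0
        (2 * Real.pi) := by
      apply Continuous.intervalIntegrable; fun_prop
    have h3 : ∫ x in (0 : ℝ)..(2 * Real.pi), e x • (I * f' x - (α : ℂ) * f x)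
        = (-(n : ℂ) - α) * ∫ x in (0 : ℝ)..(2 * Real.pi), e x • f x := by
      have : ∀ x, e x • (I * f' x - (α : ℂ) * f x) =
          I * (-I * n * e x * f x + e x * f' x) + (-(n : ℂ) - α) * (e x * f x) := by
        intro x
        simp only [smul_eq_mul]
        linear_combination ((n : ℂ) * e x * f x) * I_mul_I
      simp_rw [this]
      rw [intervalIntegral.integral_add i1 i2, intervalIntegral.integral_const_mul, hint,
        intervalIntegral.integral_const_mul]
      simp
    rw [h3]
    simp only [real_smul]
    ring
  have hle := hasSum_le (f := fun n => minDist α ^ 2 * ‖fourierCoeffOn hab f n‖ ^ 2) ?_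
    (S1.mul_left (minDist α ^ 2)) S2
  · simp only [smul_eq_mul, sub_zero] at hle
    have : (0 : ℝ) < (2 * Real.pi)⁻¹ := by positivity
    refine le_of_mul_le_mul_left ?_ this
    linarith
  · intro n
    simp only [key, norm_mul, mul_pow]
    gcongr
    · exact minDist_nonneg α
    · have := minDist_le α (-n)
      have h4 : ‖(-(n : ℂ) - α)‖ = |((-n : ℤ) : ℝ) - α| := by
        rw [← Real.norm_eq_abs, ← Complex.norm_real]; push_cast; rfl
      rw [h4]; exact this

section rot
variable {N : ℕ} (i j : Fin N)

/-- rotation by the angle `t` in the `(i, j)` plane -/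
noncomputable def rot (t : ℝ) (x : EuclideanSpace ℝ (Fin N)) : EuclideanSpace ℝ (Fin N) :=
  x + ((Real.cos t - 1) * x i - Real.sin t * x j) • EuclideanSpace.single i (1 : ℝ)
    + (Real.sin t * x i + (Real.cos t - 1) * x j) • EuclideanSpace.single j (1 : ℝ)

variable {i j}

theorem rot_i (hij : i ≠ j) (t : ℝ) (x : EuclideanSpace ℝ (Fin N)) :
    rot i j t x i = Real.cos t * x i - Real.sin t * x j := by
  simp [rot, hij]; ring

theorem rot_j (hij : i ≠ j) (t : ℝ) (x : EuclideanSpace ℝ (Fin N)) :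
    rot i j t x j = Real.sin t * x i + Real.cos t * x j := by
  simp [rot, hij.symm]; ring

theorem rot_norm (hij : i ≠ j) (t : ℝ) (x : EuclideanSpace ℝ (Fin N)) :
    ‖rot i j t x‖ = ‖x‖ := by
  have h : ‖rot i j t x‖ ^ 2 = ‖x‖ ^ 2 := by
    rw [rot, norm_add_sq_real, norm_add_sq_real, inner_add_left]
    simp only [inner_smul_left, inner_smul_right, EuclideanSpace.inner_single_right, norm_smul,
      PiLp.norm_single, mul_pow, Real.norm_eq_abs, sq_abs]
    simp [hij, hij.symm]
    linear_combination (x i ^ 2 + x j ^ 2) * Real.sin_sq_add_cos_sq t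
  exact (sq_eq_sq₀ (norm_nonneg _) (norm_nonneg _)).1 h

theorem rot_continuous : Continuous (fun p : ℝ × EuclideanSpace ℝ (Fin N) => rot i j p.1 p.2) := by
  unfold rot; fun_prop

/-- the rotation as a linear isometry -/
noncomputable def rotL (hij : i ≠ j) (t : ℝ) :
    EuclideanSpace ℝ (Fin N) →ₗᵢ[ℝ] EuclideanSpace ℝ (Fin N) where
  toFun := rot i j t
  map_add' x y := by
    ext k; simp [rot]; split_ifs <;> ring
  map_smul' c x := by
    ext k; simp [rot]; split_ifs <;> ring
  norm_map' x := rot_norm hij t x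

theorem rot_mp (hij : i ≠ j) (t : ℝ) : MeasurePreserving (rot i j t) volume volume :=
  ((rotL hij t).toLinearIsometryEquiv rfl).measurePreserving

theorem rot_integrable (hij : i ≠ j) (t : ℝ) (G : EuclideanSpace ℝ (Fin N) → ℝ)
    (hG : Integrable G) : Integrable (fun x => G (rot i j t x)) :=
  (rot_mp hij t).integrable_comp_of_integrable hG

theorem rot_integral (hij : i ≠ j) (t : ℝ) (G : EuclideanSpace ℝ (Fin N) → ℝ) :
    ∫ x, G (rot i j t x) = ∫ x, G x :=
  (rot_mp hij t).integral_comp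
    ((rotL hij t).toLinearIsometryEquiv rfl).toHomeomorph.measurableEmbedding G

theorem rot_hasDerivAt (hij : i ≠ j) (t : ℝ) (x : EuclideanSpace ℝ (Fin N)) :
    HasDerivAt (fun t => rot i j t x)
      ((-(rot i j t x j)) • EuclideanSpace.single i (1 : ℝ)
        + (rot i j t x i) • EuclideanSpace.single j (1 : ℝ)) t := by
  rw [rot_i hij, rot_j hij]
  unfold rot
  have hc := Real.hasDerivAt_cos t
  have hs := Real.hasDerivAt_sin t
  have h1 : HasDerivAt (fun t => (Real.cos t - 1) * x i - Real.sin t * x j)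
      (-(Real.sin t * x i + Real.cos t * x j)) t := by
    refine (((hc.sub_const 1).mul_const (x i)).sub (hs.mul_const (x j))).congr_deriv ?_
    ring
  have h2 : HasDerivAt (fun t => Real.sin t * x i + (Real.cos t - 1) * x j)
      (Real.cos t * x i - Real.sin t * x j) t := by
    refine ((hs.mul_const (x i)).add ((hc.sub_const 1).mul_const (x j))).congr_deriv ?_
    ring
  exact ((h1.smul_const _).const_add x).add (h2.smul_const _)

theorem avg_int (hij : i ≠ j) (G : EuclideanSpace ℝ (Fin N) → ℝ) (hc : Continuous G)
    (hG : Integrable G) :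
    Integrable (Function.uncurry fun (t : ℝ) x => G (rot i j t x))
      ((volume.restrict (Set.uIoc 0 (2 * Real.pi))).prod volume) := by
  rw [integrable_prod_iff]
  · refine ⟨Eventually.of_forall fun t => rot_integrable hij t G hG, ?_⟩
    simp only [Function.uncurry]
    have : ∀ t, ∫ x, ‖G (rot i j t x)‖ = ∫ x, ‖G x‖ := fun t =>
      rot_integral hij t (fun x => ‖G x‖)
    simp_rw [this]
    rw [Set.uIoc_of_le (by positivity)]
    apply integrable_const
  · exact (hc.comp rot_continuous).aestronglyMeasurable

theorem avg_eq (hij : i ≠ j) (G : EuclideanSpace ℝ (Fin N) → ℝ) (hc : Continuous G)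
    (hG : Integrable G) :
    ∫ x, (∫ t in (0 : ℝ)..(2 * Real.pi), G (rot i j t x)) = 2 * Real.pi * ∫ x, G x := by
  rw [← intervalIntegral_integral_swap (avg_int hij G hc hG)]
  simp_rw [rot_integral hij]
  simp

theorem avg_integrable (hij : i ≠ j) (G : EuclideanSpace ℝ (Fin N) → ℝ) (hc : Continuous G)
    (hG : Integrable G) :
    Integrable (fun x => ∫ t in (0 : ℝ)..(2 * Real.pi), G (rot i j t x)) := by
  have := (avg_int hij G hc hG).integral_prod_right
  rw [Set.uIoc_of_le (by positivity)] at this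
  simp_rw [intervalIntegral.integral_of_le (show (0 : ℝ) ≤ 2 * Real.pi by positivity)]
  exact this

end rot

/-- gluing lemma: continuity and compact support -/
theorem glue {E F : Type*} [TopologicalSpace E] [T2Space E] {φ : E → F} [Zero F]
    (hφ : HasCompactSupport φ) (G : E → ℝ) (h1 : ∀ x ∈ tsupport φ, ContinuousAt G x)
    (h0 : ∀ x ∉ tsupport φ, G x = 0) : Continuous G ∧ HasCompactSupport G := by
  constructor
  · rw [continuous_iff_continuousAt]
    intro x
    by_cases hx : x ∈ tsupport φ
    · exact h1 x hx
    · have : G =ᶠ[nhds x] fun _ => 0 := by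
        filter_upwards [(isClosed_tsupport φ).isOpen_compl.mem_nhds hx] with y hy
        exact h0 y hy
      exact continuousAt_const.congr this.symm
  · exact HasCompactSupport.intro hφ h0

theorem cs_aux (a b : ℂ) (x y : ℝ) (h : x ^ 2 + y ^ 2 ≠ 0) :
    ‖(x : ℂ) * b - (y : ℂ) * a‖ ^ 2 / (x ^ 2 + y ^ 2) ≤ ‖a‖ ^ 2 + ‖b‖ ^ 2 := by
  have hp : 0 < x ^ 2 + y ^ 2 := lt_of_le_of_ne (by positivity) (Ne.symm h)
  rw [div_le_iff₀ hp]
  rw [← Complex.normSq_eq_norm_sq, ← Complex.normSq_eq_norm_sq, ← Complex.normSq_eq_norm_sq]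
  simp only [Complex.normSq_apply, Complex.sub_re, Complex.sub_im, Complex.re_ofReal_mul,
    Complex.im_ofReal_mul]
  nlinarith [sq_nonneg (x * a.re + y * b.re), sq_nonneg (x * a.im + y * b.im)]

/-- Hardy-type inequality for the Aharonov–Bohm potential in `ℝ^N`. -/
theorem stmt_16 (N : ℕ) (hN : 4 ≤ N) (α : ℝ) :
    ∀ φ : EuclideanSpace ℝ (Fin N) → ℂ, ContDiff ℝ (⊤ : ℕ∞) φ → HasCompactSupport φ →
      Disjoint (tsupport φ) (ABsing N) →
      minDist α ^ 2 * ∫ x, ‖φ x‖ ^ 2 / (coord N 0 x ^ 2 + coord N 1 x ^ 2) ≤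
        ∫ x, abGrad2 N α φ x := by
  intro φ hφ hcs hdis
  set i : Fin N := ⟨0, by omega⟩ with hi
  set j : Fin N := ⟨1, by omega⟩ with hj
  have hij : i ≠ j := by simp [hi, hj]
  have c0 : ∀ x, coord N 0 x = x i := fun x => by
    simp only [coord]; rw [dif_pos (by omega)]
  have c1 : ∀ x, coord N 1 x = x j := fun x => by
    simp only [coord]; rw [dif_pos (by omega)]
  have hr : ∀ x ∈ tsupport φ, x i ^ 2 + x j ^ 2 ≠ 0 := by
    intro x hx h
    refine Set.disjoint_left.1 hdis hx ⟨?_, ?_⟩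
    · rw [c0]; nlinarith [sq_nonneg (x i), sq_nonneg (x j)]
    · rw [c1]; nlinarith [sq_nonneg (x i), sq_nonneg (x j)]
  have hφc : Continuous φ := hφ.continuous
  have hdc : Continuous (fderiv ℝ φ) := hφ.continuous_fderiv (by simp)
  have hz : ∀ x ∉ tsupport φ, φ x = 0 := fun x hx => image_eq_zero_of_notMem_tsupport hx
  have hdz : ∀ x ∉ tsupport φ, fderiv ℝ φ x = 0 := fun x hx => fderiv_of_notMem_tsupport ℝ hx
  let D : EuclideanSpace ℝ (Fin N) → ℂ := fun x =>
    fderiv ℝ φ x ((-(x j)) • EuclideanSpace.single i (1 : ℝ) + (x i) • EuclideanSpace.single j 1)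
  have hD : Continuous D := hdc.clm_apply (by fun_prop)
  let G1 : EuclideanSpace ℝ (Fin N) → ℝ := fun x => ‖φ x‖ ^ 2 / (x i ^ 2 + x j ^ 2)
  let G2 : EuclideanSpace ℝ (Fin N) → ℝ := fun x =>
    ‖I * D x - (α : ℂ) * φ x‖ ^ 2 / (x i ^ 2 + x j ^ 2)
  obtain ⟨G1c, G1s⟩ := glue hcs G1 (fun x hx => by
      refine ContinuousAt.div (by fun_prop) (by fun_prop) (hr x hx)) (fun x hx => by
      simp [G1, hz x hx])
  obtain ⟨G2c, G2s⟩ := glue hcs G2 (fun x hx => by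
      refine ContinuousAt.div (by fun_prop) (by fun_prop) (hr x hx)) (fun x hx => by
      simp [G2, D, hz x hx, hdz x hx])
  have hpot : ∀ x k, abPot N α x k = if (k : ℕ) = 0 then -α * x j / (x i ^ 2 + x j ^ 2)
      else if (k : ℕ) = 1 then α * x i / (x i ^ 2 + x j ^ 2) else 0 := by
    intro x k
    simp only [abPot, c0, c1]
    rfl
  obtain ⟨G3c, G3s⟩ := glue hcs (abGrad2 N α φ) (fun x hx => by
      unfold abGrad2
      refine tendsto_finsetSum _ fun k _ => ?_
      have hp : ContinuousAt (fun x => abPot N α x k) x := by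
        simp only [hpot]
        split_ifs
        · exact ContinuousAt.div (by fun_prop) (by fun_prop) (hr x hx)
        · exact ContinuousAt.div (by fun_prop) (by fun_prop) (hr x hx)
        · exact continuousAt_const
      have hp' : ContinuousAt (fun x => ((abPot N α x k : ℝ) : ℂ)) x :=
        Complex.continuous_ofReal.continuousAt.comp hp
      have hq : ContinuousAt (fun x => fderiv ℝ φ x (EuclideanSpace.single k 1)) x :=
        (hdc.clm_apply continuous_const).continuousAt
      exact (((continuousAt_const.mul hq).sub (hp'.mul hφc.continuousAt)).norm.pow 2))
    (fun x hx => by simp [abGrad2, hz x hx, hdz x hx])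
  have I1 := G1c.integrable_of_hasCompactSupport G1s (μ := volume)
  have I2 := G2c.integrable_of_hasCompactSupport G2s (μ := volume)
  have I3 := G3c.integrable_of_hasCompactSupport G3s (μ := volume)
  have h23 : ∫ x, G2 x ≤ ∫ x, abGrad2 N α φ x := by
    refine integral_mono I2 I3 fun x => ?_
    by_cases hx : x ∈ tsupport φ
    · have hrx := hr x hx
      set a : ℂ := I * fderiv ℝ φ x (EuclideanSpace.single i 1) - ((abPot N α x i : ℝ) : ℂ) * φ x
        with ha
      set b : ℂ := I * fderiv ℝ φ x (EuclideanSpace.single j 1) - ((abPot N α x j : ℝ) : ℂ) * φ x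
        with hb
      have hsum : ‖a‖ ^ 2 + ‖b‖ ^ 2 ≤ abGrad2 N α φ x := by
        have := Finset.sum_le_sum_of_subset_of_nonneg (Finset.subset_univ ({i, j} : Finset (Fin N)))
          (f := fun k => ‖I * fderiv ℝ φ x (EuclideanSpace.single k 1)
            - ((abPot N α x k : ℝ) : ℂ) * φ x‖ ^ 2) (fun k _ _ => by positivity)
        rw [Finset.sum_pair hij] at this
        exact this
      refine le_trans ?_ hsum
      refine le_trans (le_of_eq ?_) (cs_aux a b (x i) (x j) hrx)
      simp only [G2]
      congr 3
      have hrC : (x i : ℂ) ^ 2 + (x j : ℂ) ^ 2 ≠ 0 := by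
        have := Complex.ofReal_ne_zero.2 hrx
        push_cast at this
        exact this
      have pi_ : abPot N α x i = -α * x j / (x i ^ 2 + x j ^ 2) := by
        rw [hpot]; simp [hi]
      have pj_ : abPot N α x j = α * x i / (x i ^ 2 + x j ^ 2) := by
        rw [hpot]; simp [hj]
      simp only [D, ha, hb, pi_, pj_, map_add, map_smul, real_smul]
      push_cast
      field_simp
      ring
    · simp [G2, D, abGrad2, hz x hx, hdz x hx]
  have h12 : minDist α ^ 2 * ∫ x, G1 x ≤ ∫ x, G2 x := by
    have hm : ∫ x, minDist α ^ 2 * (∫ t in (0 : ℝ)..(2 * Real.pi), G1 (rot i j t x))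
        ≤ ∫ x, (∫ t in (0 : ℝ)..(2 * Real.pi), G2 (rot i j t x)) := by
      refine integral_mono ((avg_integrable hij G1 G1c I1).const_mul _)
        (avg_integrable hij G2 G2c I2) fun x => ?_
      have hinv : ∀ t, rot i j t x i ^ 2 + rot i j t x j ^ 2 = x i ^ 2 + x j ^ 2 := by
        intro t
        rw [rot_i hij, rot_j hij]
        linear_combination (x i ^ 2 + x j ^ 2) * Real.sin_sq_add_cos_sq t
      simp only [G1, G2, hinv, intervalIntegral.integral_div]
      rw [← mul_div_assoc]
      have hrc : Continuous (fun t => rot i j t x) :=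
        rot_continuous.comp (continuous_id.prodMk continuous_const)
      have := circle_ineq α (fun t => φ (rot i j t x)) (fun t => D (rot i j t x)) (fun t =>
        ((hφ.differentiable (by simp)) (rot i j t x)).hasFDerivAt.comp_hasDerivAt t
          (rot_hasDerivAt hij t x)) (hD.comp hrc) (by simp [rot])
      gcongr
    rw [integral_const_mul, avg_eq hij G1 G1c I1, avg_eq hij G2 G2c I2] at hm
    refine le_of_mul_le_mul_left ?_ (show (0 : ℝ) < 2 * Real.pi by positivity)
    linarith
  simp only [c0, c1]
  exact h12.trans h23
end
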